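/- Let q be a power of a prime and F_q the finite field with q elements. Let A, B ⊆ F_q with 2 ≤ |B| ≤ |A|, and suppose there is a constant C > 0 such that for every proper subfield G of F_q and all elements c, d ∈ F_q one has |A ∩ (cG + d)| ≤ C·max{|G|^{1/2}, |A|^{31/191}|B|^{129/191}}. Then there is a constant C' > 0 depending only on C such that for every finite set L of lines in F_q^2, I(A × B, L) ≤ C'·((|A|^{383/573}|B|^{571/573} + q^{-1/309}|A|^{207/309}|B| + |A||B|^{1/3})·|L|^{2/3} + |L|). -/

import Mathlib

open scoped Classical Pointwise

noncomputable section

namespace STP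

variable {F : Type} [Field F]

def collinearTriples (A B : Finset F) : ℕ :=
  (((A ×ˢ A ×ˢ A) ×ˢ (B ×ˢ B ×ˢ B)).filter fun x =>
    (x.1.2.1 - x.1.1) * (x.2.2.2 - x.2.1) = (x.1.2.2 - x.1.1) * (x.2.2.1 - x.2.1)).card

def IsLine (l : Set (F × F)) : Prop :=
  ∃ a b c : F, (a, b) ≠ (0, 0) ∧ l = {p : F × F | a * p.1 + b * p.2 = c}

def incidences (P : Finset (F × F)) (L : Finset (Set (F × F))) : ℕ :=
  ((P ×ˢ L).filter fun x => x.1 ∈ x.2).card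

def kIncidences (P : Finset (F × F)) (L : Finset (Set (F × F))) (k : ℕ) : ℕ :=
  (((Fintype.piFinset fun _ : Fin k => P) ×ˢ L).filter fun x => ∀ i, x.1 i ∈ x.2).card

def numLines (P : Finset (F × F)) : ℕ :=
  Set.ncard {l : Set (F × F) | IsLine l ∧ 2 ≤ (P.filter (· ∈ l)).card}

def addEnergy (X Y : Finset F) : ℕ :=
  (((X ×ˢ X) ×ˢ (Y ×ˢ Y)).filter fun t => t.1.1 + t.2.1 = t.1.2 + t.2.2).card

def mulEnergy (A : Finset F) : ℕ :=
  (((A ×ˢ A) ×ˢ (A ×ˢ A)).filter fun t => t.1.1 * t.2.1 = t.1.2 * t.2.2).card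

def quotSet (X : Finset F) : Set F :=
  {r : F | ∃ x1 ∈ X, ∃ x2 ∈ X, ∃ x3 ∈ X, ∃ x4 ∈ X, x3 ≠ x4 ∧ r = (x1 - x2) / (x3 - x4)}

def subfieldCond (A : Finset F) (C bound : ℝ) : Prop :=
  ∀ G : Subfield F, G ≠ ⊤ → ∀ c d : F,
    ((A.filter fun x => ∃ g ∈ G, x = c * g + d).card : ℝ) ≤
      C * max ((Nat.card G : ℝ) ^ ((1:ℝ)/2)) bound

def linesOf [Fintype F] (P : Finset (F × F)) : Finset (Set (F × F)) :=
  Set.Finite.toFinset (Set.toFinite {l : Set (F × F) | IsLine l ∧ 2 ≤ (P.filter (· ∈ l)).card})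

def tripleCount [Fintype F] (P : Finset (F × F)) : ℕ :=
  ∑ l ∈ linesOf P, ((P.filter (· ∈ l)).card) ^ 3


def dil (z : F) (X : Finset F) : Finset F := X.image (fun x => z * x)

theorem mem_dil {z : F} {X : Finset F} {y : F} : y ∈ dil z X ↔ ∃ x ∈ X, z * x = y := by
  simp [dil]

theorem card_dil {z : F} (hz : z ≠ 0) (X : Finset F) : (dil z X).card = X.card :=
  Finset.card_image_of_injective _ (mul_right_injective₀ hz)

theorem dil_sub (z : F) (X Y : Finset F) : dil z (X - Y) = dil z X - dil z Y := by
  ext y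
  simp only [mem_dil, Finset.mem_sub]
  constructor
  · rintro ⟨_, ⟨a, ha, b, hb, rfl⟩, rfl⟩
    exact ⟨_, ⟨a, ha, rfl⟩, _, ⟨b, hb, rfl⟩, by ring⟩
  · rintro ⟨_, ⟨a, ha, rfl⟩, _, ⟨b, hb, rfl⟩, rfl⟩
    exact ⟨_, ⟨a, ha, b, hb, rfl⟩, by ring⟩

theorem dil_dil (z w : F) (X : Finset F) : dil z (dil w X) = dil (z * w) X := by
  ext y
  simp [dil, Finset.mem_image, mul_assoc]

/-- Ruzsa triangle inequality in the real form used below. -/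
theorem tri (A B C : Finset F) :
    ((A - C).card : ℝ) * (B.card : ℝ) ≤ ((A - B).card : ℝ) * ((B - C).card : ℝ) := by
  have h := Finset.ruzsa_triangle_inequality_sub_sub_sub A B C
  have h2 : (C - B).card = (B - C).card := by
    rw [← Finset.card_neg (C - B), neg_sub]
  rw [h2] at h
  exact_mod_cast h

/-- Size of `X - zX` under products. -/
theorem D_mul (X : Finset F) (z w : F) (k l : ℝ) (hl1 : 1 ≤ l) (hX : X.Nonempty)
    (hz : ((X - dil z X).card : ℝ) ≤ k * X.card) (hw : ((X - dil w X).card : ℝ) ≤ l * X.card) :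
    ((X - dil (z * w) X).card : ℝ) ≤ k * l * X.card := by
  have hXp : (0:ℝ) < X.card := by exact_mod_cast hX.card_pos
  have hk : 0 ≤ k := by
    by_contra h
    have : k * X.card < 0 := by nlinarith
    have : (0:ℝ) ≤ ((X - dil z X).card : ℝ) := by positivity
    linarith
  by_cases h0 : z = 0
  · subst h0
    rw [zero_mul]
    calc _ ≤ k * (X.card : ℝ) := hz
      _ ≤ k * l * X.card := by
        have : k * 1 ≤ k * l := by gcongr
        nlinarith
  · have h := tri X (dil z X) (dil (z * w) X)
    rw [card_dil h0, ← dil_dil, ← dil_sub, card_dil h0] at h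
    have : ((X - dil z X).card : ℝ) * ((X - dil w X).card : ℝ) ≤ (k * X.card) * (l * X.card) := by
      gcongr
    rw [← dil_dil]
    nlinarith

theorem D_ratio (X : Finset F) (S : Finset F) (K : ℝ) (hX : X.Nonempty)
    (hS : ∀ s ∈ S, ((X - dil s X).card : ℝ) ≤ K * X.card) (m n : ℕ) (l : ℝ)
    (hl : (S.card : ℝ) ≤ l) (hK : 0 ≤ K) :
    ((m • (S.biUnion fun s => dil s X) - n • (S.biUnion fun s => dil s X)).card : ℝ)
      ≤ (l * K) ^ (m + n) * X.card := by
  set B := S.biUnion fun s => dil s X with hB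
  have hXp : (0:ℝ) < X.card := by exact_mod_cast hX.card_pos
  have h1 : ((X - B).card : ℝ) ≤ l * K * X.card := by
    have hsub : X - B ⊆ S.biUnion fun s => (X - dil s X) := by
      intro y hy
      obtain ⟨a, ha, b, hb, rfl⟩ := Finset.mem_sub.1 hy
      obtain ⟨s, hs, hb⟩ := Finset.mem_biUnion.1 hb
      exact Finset.mem_biUnion.2 ⟨s, hs, Finset.sub_mem_sub ha hb⟩
    have h2 : ((X - B).card : ℝ) ≤ ∑ s ∈ S, ((X - dil s X).card : ℝ) := by
      exact_mod_cast (Finset.card_le_card hsub).trans Finset.card_biUnion_le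
    calc _ ≤ _ := h2
      _ ≤ ∑ s ∈ S, K * (X.card : ℝ) := Finset.sum_le_sum hS
      _ = S.card * (K * X.card) := by simp
      _ ≤ l * (K * X.card) := by gcongr
      _ = _ := by ring
  have h := Finset.pluennecke_ruzsa_inequality_nsmul_sub_nsmul_sub hX B m n
  have h' : ((m • B - n • B).card : ℝ) ≤ ((X - B).card / X.card : ℝ) ^ (m + n) * X.card := by
    have h3 := (NNRat.cast_le (K := ℝ)).2 h
    push_cast at h3
    exact h3
  refine h'.trans ?_
  gcongr
  rw [div_le_iff₀ hXp]
  exact h1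

theorem cs_count {α β : Type} (s : Finset α) (f : α → β) :
    s.card ^ 2 ≤ (s.image f).card * ((s ×ˢ s).filter fun p => f p.1 = f p.2).card := by
  have h1 : s.card = ∑ y ∈ s.image f, (s.filter fun x => f x = y).card :=
    Finset.card_eq_sum_card_image f s
  have h2 : ((s ×ˢ s).filter fun p => f p.1 = f p.2).card
      = ∑ y ∈ s.image f, (s.filter fun x => f x = y).card ^ 2 := by
    rw [Finset.card_eq_sum_card_fiberwise (f := fun p => f p.1) (t := s.image f)]
    · refine Finset.sum_congr rfl fun y hy => ?_
      rw [sq, ← Finset.card_product]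
      congr 1
      ext ⟨a, b⟩
      simp only [Finset.mem_filter, Finset.mem_product]
      constructor
      · rintro ⟨⟨⟨ha, hb⟩, hab⟩, h⟩
        exact ⟨⟨ha, h⟩, hb, by rw [← hab]; exact h⟩
      · rintro ⟨⟨ha, h⟩, hb, h'⟩
        exact ⟨⟨⟨ha, hb⟩, by rw [h, h']⟩, h⟩
    · intro p hp
      simp only [Finset.coe_filter, Finset.mem_product, Set.mem_ofPred_eq] at hp
      exact Finset.mem_coe.2 (Finset.mem_image_of_mem _ hp.1.1)
  rw [h2]
  conv_lhs => rw [h1]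
  exact sq_sum_le_card_mul_sum_sq

/-- Quadruple count for `X - zX`. -/
def En (X : Finset F) (z : F) : ℕ :=
  (((X ×ˢ X) ×ˢ (X ×ˢ X)).filter fun p => p.1.1 - z * p.1.2 = p.2.1 - z * p.2.2).card

theorem En_lower (X : Finset F) (z : F) :
    X.card ^ 4 ≤ (X - dil z X).card * En X z := by
  have h := cs_count (X ×ˢ X) (fun p : F × F => p.1 - z * p.2)
  rw [Finset.card_product] at h
  have h2 : ((X ×ˢ X).image (fun p : F × F => p.1 - z * p.2)) ⊆ X - dil z X := by
    intro y hy
    obtain ⟨p, hp, rfl⟩ := Finset.mem_image.1 hy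
    rw [Finset.mem_product] at hp
    exact Finset.sub_mem_sub hp.1 (mem_dil.2 ⟨_, hp.2, rfl⟩)
  calc X.card ^ 4 = (X.card * X.card) ^ 2 := by ring
    _ ≤ _ := h
    _ ≤ _ := Nat.mul_le_mul (Finset.card_le_card h2) le_rfl

/-- Sum of the quadruple counts, split into degenerate and nondegenerate ones. -/
theorem En_sum (X Z : Finset F) (W : Set F) (hZ : ∀ z ∈ Z, z ∈ W) :
    ∑ z ∈ Z, En X z ≤ Z.card * X.card ^ 2 +
      (((X ×ˢ X) ×ˢ (X ×ˢ X)).filter fun p => p.1.2 ≠ p.2.2 ∧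
        ∃ w ∈ W, p.1.1 = w * (p.1.2 - p.2.2) + p.2.1).card := by
  have h0 : ∀ z ∈ Z, En X z ≤ X.card ^ 2 +
      (((X ×ˢ X) ×ˢ (X ×ˢ X)).filter fun p => p.1.2 ≠ p.2.2 ∧
        p.1.1 = z * (p.1.2 - p.2.2) + p.2.1).card := by
    intro z hz
    have hsub : (((X ×ˢ X) ×ˢ (X ×ˢ X)).filter fun p => p.1.1 - z * p.1.2 = p.2.1 - z * p.2.2) ⊆
        ((X ×ˢ X).image fun p => (p, p)) ∪ (((X ×ˢ X) ×ˢ (X ×ˢ X)).filter fun p => p.1.2 ≠ p.2.2 ∧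
        p.1.1 = z * (p.1.2 - p.2.2) + p.2.1) := by
      rintro ⟨⟨a, b⟩, ⟨c, d⟩⟩ hp
      simp only [Finset.mem_filter, Finset.mem_product] at hp
      simp only [Finset.mem_union, Finset.mem_image, Finset.mem_filter, Finset.mem_product]
      by_cases hbd : b = d
      · left
        subst hbd
        exact ⟨(a, b), hp.1.1, by simpa using hp.2⟩
      · right
        exact ⟨hp.1, hbd, by linear_combination hp.2⟩
    refine (Finset.card_le_card hsub).trans ((Finset.card_union_le _ _).trans ?_)
    refine Nat.add_le_add_right ?_ _
    refine Finset.card_image_le.trans ?_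
    rw [Finset.card_product, sq]
  refine (Finset.sum_le_sum h0).trans ?_
  rw [Finset.sum_add_distrib, Finset.sum_const, smul_eq_mul]
  refine Nat.add_le_add_left ?_ _
  rw [← Finset.card_biUnion]
  · refine Finset.card_le_card ?_
    intro p hp
    simp only [Finset.mem_biUnion, Finset.mem_filter] at hp ⊢
    obtain ⟨z, hz, h1, h2, h3⟩ := hp
    exact ⟨h1, h2, z, hZ z hz, h3⟩
  · intro z hz w hw hzw
    rw [Function.onFun, Finset.disjoint_left]
    intro p hp hq
    simp only [Finset.mem_filter] at hp hq
    apply hzw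
    have h1 := hp.2.2
    have h2 := hq.2.2
    have h3 : p.1.2 - p.2.2 ≠ 0 := sub_ne_zero.2 hp.2.1
    exact mul_right_cancel₀ h3 (by linear_combination h2 - h1)

theorem exists_large (X Z : Finset F) (hX : X.Nonempty) (hZ : Z.Nonempty) (M : ℝ)
    (hM : ∀ z ∈ Z, ((X - dil z X).card : ℝ) ≤ M * X.card) :
    (X.card : ℝ) ≤ 2 * M ∨ (Z.card : ℝ) ≤ 2 * M * X.card := by
  have hXp : (0:ℝ) < X.card := by exact_mod_cast hX.card_pos
  have hZp : (0:ℝ) < Z.card := by exact_mod_cast hZ.card_pos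
  have h1 : ∀ z ∈ Z, (X.card : ℝ) ^ 3 ≤ M * En X z := by
    intro z hz
    have h := En_lower X z
    have h' : (X.card : ℝ) ^ 4 ≤ ((X - dil z X).card : ℝ) * En X z := by exact_mod_cast h
    have h2 : ((X - dil z X).card : ℝ) * En X z ≤ (M * X.card) * En X z := by
      gcongr; exact hM z hz
    have : (X.card : ℝ) * (X.card : ℝ) ^ 3 ≤ X.card * (M * En X z) := by nlinarith
    exact le_of_mul_le_mul_left this hXp
  have h2 := En_sum X Z Set.univ (fun _ _ => Set.mem_univ _)
  have h3 : (((X ×ˢ X) ×ˢ (X ×ˢ X)).filter fun p => p.1.2 ≠ p.2.2 ∧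
        ∃ w ∈ (Set.univ : Set F), p.1.1 = w * (p.1.2 - p.2.2) + p.2.1).card ≤ X.card ^ 4 := by
    refine (Finset.card_filter_le _ _).trans ?_
    simp only [Finset.card_product]
    apply le_of_eq; ring
  have h4 : ((∑ z ∈ Z, En X z : ℕ) : ℝ) ≤ Z.card * (X.card : ℝ) ^ 2 + (X.card : ℝ) ^ 4 := by
    exact_mod_cast h2.trans (Nat.add_le_add_left h3 _)
  have h5 : (Z.card : ℝ) * (X.card : ℝ) ^ 3 ≤ M * ((∑ z ∈ Z, En X z : ℕ) : ℝ) := by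
    push_cast
    rw [Finset.mul_sum]
    calc _ = ∑ z ∈ Z, (X.card : ℝ) ^ 3 := by simp
      _ ≤ _ := Finset.sum_le_sum h1
  have hM0 : 0 ≤ M := by
    obtain ⟨z, hz⟩ := hZ
    have := hM z hz
    by_contra h
    have h6 : M * X.card < 0 := by nlinarith
    have : (0:ℝ) ≤ ((X - dil z X).card : ℝ) := by positivity
    linarith
  by_contra hcon
  push Not at hcon
  obtain ⟨c1, c2⟩ := hcon
  have h6 : (Z.card : ℝ) * (X.card : ℝ) ^ 3
      ≤ M * (Z.card * (X.card : ℝ) ^ 2 + (X.card : ℝ) ^ 4) := h5.trans (by gcongr)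
  have h7 : (2 * M) * (Z.card * (X.card : ℝ) ^ 2) < X.card * (Z.card * (X.card : ℝ) ^ 2) := by
    gcongr
  have h8 : (2 * M * X.card) * (X.card : ℝ) ^ 3 < Z.card * (X.card : ℝ) ^ 3 := by
    gcongr
  nlinarith


def cosetCount (X : Finset F) (G : Subfield F) (c d : F) : ℕ :=
  (X.filter fun x => ∃ g ∈ G, x = c * g + d).card

theorem pivot [Fintype F] (S : Finset F) (h0 : (0:F) ∈ S) (h1 : (1:F) ∈ S) :
    (∃ r ∈ quotSet S, 1 + r ∉ quotSet S) ∨ (∃ s ∈ S, ∃ r ∈ quotSet S, s * r ∉ quotSet S) ∨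
      ∃ G : Subfield F, (∀ s ∈ S, s ∈ G) ∧ ∀ g ∈ G, g ∈ quotSet S := by
  by_contra hcon
  push Not at hcon
  obtain ⟨hA, hM, hG⟩ := hcon
  set R := quotSet S with hR
  have hneg : ∀ r ∈ R, -r ∈ R := by
    rintro r ⟨x1, m1, x2, m2, x3, m3, x4, m4, hne, rfl⟩
    exact ⟨x2, m2, x1, m1, x3, m3, x4, m4, hne, by ring⟩
  have hzero : (0:F) ∈ R := ⟨0, h0, 0, h0, 1, h1, 0, h0, one_ne_zero, by simp⟩
  -- multiplication by the inverse of a nonzero element of `S`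
  have hinv : ∀ s ∈ S, s ≠ 0 → ∀ r ∈ R, ∃ r' ∈ R, s * r' = r := by
    intro s hs hs0
    have hmaps : Set.MapsTo (fun r => s * r) R R := fun r hr => hM s hs r hr
    have hinj : Set.InjOn (fun r => s * r) R := (mul_right_injective₀ hs0).injOn
    have hsurj : Set.SurjOn (fun r => s * r) R R :=
      ((Set.toFinite R).injOn_iff_bijOn_of_mapsTo hmaps).1 hinj |>.surjOn
    intro r hr
    obtain ⟨r', hr', h⟩ := hsurj hr
    exact ⟨r', hr', h⟩
  -- additive stabilizer
  let St : AddSubgroup F :=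
    { carrier := {x | ∀ r ∈ R, x + r ∈ R}
      zero_mem' := fun r hr => by simpa using hr
      add_mem' := fun {a b} ha hb r hr => by rw [add_assoc]; exact ha _ (hb _ hr)
      neg_mem' := fun {a} ha r hr => by
        have := hneg _ (ha _ (hneg r hr))
        simpa [add_comm] using this }
  have hSt : ∀ x, x ∈ St ↔ ∀ r ∈ R, x + r ∈ R := fun x => Iff.rfl
  have hone : (1:F) ∈ St := fun r hr => hA r hr
  let M : Subring F :=
    { carrier := {x | ∀ y ∈ St, x * y ∈ St}
      zero_mem' := fun y hy => by rw [zero_mul]; exact St.zero_mem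
      one_mem' := fun y hy => by rwa [one_mul]
      add_mem' := fun {a b} ha hb y hy => by rw [add_mul]; exact St.add_mem (ha y hy) (hb y hy)
      mul_mem' := fun {a b} ha hb y hy => by rw [mul_assoc]; exact ha _ (hb y hy)
      neg_mem' := fun {a} ha y hy => by rw [neg_mul]; exact St.neg_mem (ha y hy) }
  have hMS : ∀ s ∈ S, s ∈ M := by
    intro s hs y hy
    by_cases hs0 : s = 0
    · rw [hs0, zero_mul]; exact St.zero_mem
    · intro r hr
      obtain ⟨r', hr', rfl⟩ := hinv s hs hs0 r hr
      rw [← mul_add]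
      exact hM s hs _ (hy r' hr')
  let G : Subfield F :=
    { M with
      inv_mem' := by
        intro x hx
        by_cases hx0 : x = 0
        · subst hx0; rw [inv_zero]; exact M.zero_mem
        · have hx' : x ∈ M := hx
          have hc : 2 ≤ Fintype.card F := Fintype.one_lt_card
          have h : x⁻¹ = x ^ (Fintype.card F - 2) := by
            have h2 := FiniteField.pow_card_sub_one_eq_one x hx0
            apply inv_eq_of_mul_eq_one_right
            rw [← pow_succ', ← h2]
            congr 1
            omega
          rw [h]
          exact M.pow_mem hx' _ }
  obtain ⟨g, hg, hgR⟩ := hG G hMS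
  apply hgR
  have hg' : g ∈ M := hg
  have h2 : g * 1 ∈ St := hg' 1 hone
  have h3 := h2 0 hzero
  simpa using h3

theorem D_quot (X S : Finset F) (K : ℝ) (hX : X.Nonempty) (hK : 1 ≤ K)
    (hS : ∀ s ∈ S, ((X - dil s X).card : ℝ) ≤ K * X.card) (r : F) (hr : r ∈ quotSet S) :
    ((X - dil r X).card : ℝ) ≤ (4 * K) ^ 4 * X.card := by
  obtain ⟨x1, m1, x2, m2, x3, m3, x4, m4, hne, rfl⟩ := hr
  have hv : x3 - x4 ≠ 0 := sub_ne_zero.2 hne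
  have hc4 : ((({x1, x2, x3, x4} : Finset F)).card : ℝ) ≤ 4 := by
    exact_mod_cast Finset.card_le_four
  have h := D_ratio X {x1, x2, x3, x4} K hX (fun s hs => hS s (by
    simp only [Finset.mem_insert, Finset.mem_singleton] at hs
    rcases hs with rfl | rfl | rfl | rfl <;> assumption)) 2 2 4 hc4 (by linarith)
  refine le_trans ?_ h
  rw [← card_dil hv (X - dil ((x1 - x2) / (x3 - x4)) X), dil_sub, dil_dil, mul_div_cancel₀ _ hv]
  norm_cast
  apply Finset.card_le_card
  intro y hy
  obtain ⟨_, ha', _, hb', rfl⟩ := Finset.mem_sub.1 hy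
  obtain ⟨a, ha, rfl⟩ := mem_dil.1 ha'
  obtain ⟨b, hb, rfl⟩ := mem_dil.1 hb'
  have e : (x3 - x4) * a - (x1 - x2) * b = (x3 * a + x2 * b) - (x4 * a + x1 * b) := by ring
  rw [e, two_nsmul]
  have key : ∀ t ∈ ({x1, x2, x3, x4} : Finset F), ∀ c ∈ X,
      t * c ∈ ({x1, x2, x3, x4} : Finset F).biUnion fun s => dil s X := fun t ht c hc =>
    Finset.mem_biUnion.2 ⟨t, ht, mem_dil.2 ⟨c, hc, rfl⟩⟩
  exact Finset.sub_mem_sub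
    (Finset.add_mem_add (key x3 (by simp) a ha) (key x2 (by simp) b hb))
    (Finset.add_mem_add (key x4 (by simp) a ha) (key x1 (by simp) b hb))

/-- Cost of a three-term dilate. -/
theorem D_sum (X : Finset F) (t t' w : F) (K M : ℝ) (hX : X.Nonempty) (hK : 1 ≤ K)
    (h1 : ((X - dil 1 X).card : ℝ) ≤ K * X.card)
    (ht : ((X - dil t X).card : ℝ) ≤ K * X.card)
    (ht' : ((X - dil t' X).card : ℝ) ≤ K * X.card)
    (hw : ((X - dil w X).card : ℝ) ≤ M * X.card) :
    ((X - dil (t + t' + w) X).card : ℝ) ≤ (3 * K) ^ 4 * M * X.card := by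
  have hXp : (0:ℝ) < X.card := by exact_mod_cast hX.card_pos
  have hc3 : ((({1, t, t'} : Finset F)).card : ℝ) ≤ 3 := by
    exact_mod_cast Finset.card_le_three
  have h := D_ratio X {1, t, t'} K hX (fun s hs => by
    simp only [Finset.mem_insert, Finset.mem_singleton] at hs
    rcases hs with rfl | rfl | rfl <;> assumption) 1 3 3 hc3 (by linarith)
  have key : ∀ t₀ ∈ ({1, t, t'} : Finset F), ∀ c ∈ X,
      t₀ * c ∈ ({1, t, t'} : Finset F).biUnion fun s => dil s X := fun t ht c hc =>
    Finset.mem_biUnion.2 ⟨t, ht, mem_dil.2 ⟨c, hc, rfl⟩⟩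
  set B := ({1, t, t'} : Finset F).biUnion fun s => dil s X with hB
  set Y := X - dil t X - dil t' X with hY
  have hYX : ((Y - X).card : ℝ) ≤ (3 * K) ^ 4 * X.card := by
    refine le_trans ?_ h
    norm_cast
    apply Finset.card_le_card
    intro y hy
    obtain ⟨_, hy1, x', hx', rfl⟩ := Finset.mem_sub.1 hy
    obtain ⟨_, hy2, _, hb', rfl⟩ := Finset.mem_sub.1 hy1
    obtain ⟨x, hx, _, hc', rfl⟩ := Finset.mem_sub.1 hy2
    obtain ⟨b, hb, rfl⟩ := mem_dil.1 hb'
    obtain ⟨c, hc, rfl⟩ := mem_dil.1 hc'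
    have e : x - t * c - t' * b - x' = 1 * x - (t * c + t' * b + 1 * x') := by ring
    have e3 : (3:ℕ) • B = B + B + B := by
      rw [succ_nsmul, two_nsmul]
    rw [e, one_nsmul, e3]
    exact Finset.sub_mem_sub (key 1 (by simp) x hx)
      (Finset.add_mem_add (Finset.add_mem_add (key t (by simp) c hc) (key t' (by simp) b hb))
        (key 1 (by simp) x' hx'))
  have hsub : X - dil (t + t' + w) X ⊆ Y - dil w X := by
    intro y hy
    obtain ⟨x, hx, _, hb', rfl⟩ := Finset.mem_sub.1 hy
    obtain ⟨b, hb, rfl⟩ := mem_dil.1 hb'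
    have e : x - (t + t' + w) * b = x - t * b - t' * b - w * b := by ring
    rw [e]
    exact Finset.sub_mem_sub (Finset.sub_mem_sub (Finset.sub_mem_sub hx (mem_dil.2 ⟨b, hb, rfl⟩))
      (mem_dil.2 ⟨b, hb, rfl⟩)) (mem_dil.2 ⟨b, hb, rfl⟩)
  have h3 : ((X - dil (t + t' + w) X).card : ℝ) ≤ ((Y - dil w X).card : ℝ) := by
    exact_mod_cast Finset.card_le_card hsub
  have h4 := tri Y X (dil w X)
  have h5 : ((Y - X).card : ℝ) * ((X - dil w X).card : ℝ)
      ≤ ((3 * K) ^ 4 * X.card) * (M * X.card) := by gcongr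
  have h6 : ((Y - dil w X).card : ℝ) * X.card ≤ ((3 * K) ^ 4 * M * X.card) * X.card := by
    nlinarith
  exact h3.trans (le_of_mul_le_mul_right h6 hXp)

theorem growth (X S : Finset F) (K : ℝ) (hX : X.Nonempty) (hS0 : S.Nonempty) (r : F)
    (hr : r ∉ quotSet S)
    (h : ∀ t ∈ S, ∀ t' ∈ S, ((X - dil (t + r * t') X).card : ℝ) ≤ K * X.card) :
    (X.card : ℝ) ≤ 2 * K ∨ (S.card : ℝ) ^ 2 ≤ 2 * K * X.card := by
  have hinj : Set.InjOn (fun p : F × F => p.1 + r * p.2) ((S ×ˢ S : Finset (F × F)) : Set (F × F)) := by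
    rintro ⟨a, b⟩ hab ⟨c, d⟩ hcd heq
    simp only [Finset.coe_product, Set.mem_prod, Finset.mem_coe] at hab hcd
    simp only at heq
    by_cases hbd : b = d
    · subst hbd
      simpa using heq
    · exfalso
      apply hr
      have hne : b - d ≠ 0 := sub_ne_zero.2 hbd
      refine ⟨c, hcd.1, a, hab.1, b, hab.2, d, hcd.2, hbd, ?_⟩
      rw [eq_div_iff hne]
      linear_combination heq
  have hc : ((S ×ˢ S).image fun p : F × F => p.1 + r * p.2).card = S.card ^ 2 := by
    rw [Finset.card_image_of_injOn hinj, Finset.card_product, sq]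
  have := exists_large X ((S ×ˢ S).image fun p : F × F => p.1 + r * p.2) hX
    ((hS0.product hS0).image _) K (by
      intro z hz
      obtain ⟨p, hp, rfl⟩ := Finset.mem_image.1 hz
      rw [Finset.mem_product] at hp
      exact h _ hp.1 _ hp.2)
  rw [hc] at this
  exact_mod_cast this

theorem subfield_dense (X S : Finset F) (K : ℝ) (hX : X.Nonempty) (hK : 1 ≤ K)
    (h1 : (1 : F) ∈ S)
    (hS : ∀ s ∈ S, ((X - dil s X).card : ℝ) ≤ K * X.card) (G : Subfield F)
    (hSG : ∀ s ∈ S, s ∈ G) (hbig : 2 * K < X.card) :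
    ∃ c d : F, (S.card : ℝ) ≤ 2 * K * (cosetCount X G c d : ℝ) := by
  by_contra hcon
  push Not at hcon
  have hXp : (0:ℝ) < X.card := by exact_mod_cast hX.card_pos
  have hSp : (0:ℝ) < S.card := by exact_mod_cast Finset.card_pos.2 ⟨1, h1⟩
  have hE : ∀ s ∈ S, (X.card : ℝ) ^ 3 ≤ K * En X s := by
    intro z hz
    have h' : (X.card : ℝ) ^ 4 ≤ ((X - dil z X).card : ℝ) * En X z := by
      exact_mod_cast En_lower X z
    have h2 : ((X - dil z X).card : ℝ) * En X z ≤ (K * X.card) * En X z := by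
      gcongr; exact hS z hz
    have : (X.card : ℝ) * (X.card : ℝ) ^ 3 ≤ X.card * (K * En X z) := by nlinarith
    exact le_of_mul_le_mul_left this hXp
  have hE2 : (S.card : ℝ) * (X.card : ℝ) ^ 3 ≤ K * ((∑ z ∈ S, En X z : ℕ) : ℝ) := by
    push_cast
    rw [Finset.mul_sum]
    calc _ = ∑ z ∈ S, (X.card : ℝ) ^ 3 := by simp
      _ ≤ _ := Finset.sum_le_sum hE
  have hsum := En_sum X S (G : Set F) hSG
  have hcount : 2 * K * ((((X ×ˢ X) ×ˢ (X ×ˢ X)).filter fun p => p.1.2 ≠ p.2.2 ∧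
        ∃ w ∈ (G : Set F), p.1.1 = w * (p.1.2 - p.2.2) + p.2.1).card : ℝ)
        ≤ (X.card : ℝ) ^ 3 * S.card := by
    have hsub : (((X ×ˢ X) ×ˢ (X ×ˢ X)).filter fun p => p.1.2 ≠ p.2.2 ∧
        ∃ w ∈ (G : Set F), p.1.1 = w * (p.1.2 - p.2.2) + p.2.1) ⊆
        (X ×ˢ X ×ˢ X).biUnion fun y =>
          (X.filter fun x => ∃ g ∈ G, x = (y.1 - y.2.2) * g + y.2.1).image
            fun x => ((x, y.1), (y.2.1, y.2.2)) := by
      rintro ⟨⟨a, b⟩, ⟨c, d⟩⟩ hp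
      simp only [Finset.mem_filter, Finset.mem_product] at hp
      obtain ⟨⟨⟨ha, hb⟩, hc, hd⟩, hbd, w, hw, he⟩ := hp
      rw [Finset.mem_biUnion]
      refine ⟨(b, c, d), by simp [hb, hc, hd], Finset.mem_image.2 ⟨a, ?_, rfl⟩⟩
      rw [Finset.mem_filter]
      exact ⟨ha, w, hw, by rw [he]; ring⟩
    have h2 := (Finset.card_le_card hsub).trans Finset.card_biUnion_le
    have h3 : ((((X ×ˢ X) ×ˢ (X ×ˢ X)).filter fun p => p.1.2 ≠ p.2.2 ∧
        ∃ w ∈ (G : Set F), p.1.1 = w * (p.1.2 - p.2.2) + p.2.1).card : ℝ) ≤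
        ∑ y ∈ X ×ˢ X ×ˢ X, (cosetCount X G (y.1 - y.2.2) y.2.1 : ℝ) := by
      refine le_trans (Nat.cast_le.2 h2) ?_
      rw [Nat.cast_sum]
      exact Finset.sum_le_sum fun y _ => by exact_mod_cast Finset.card_image_le
    calc _ ≤ 2 * K * ∑ y ∈ X ×ˢ X ×ˢ X,
          (cosetCount X G (y.1 - y.2.2) y.2.1 : ℝ) := by gcongr
      _ = ∑ y ∈ X ×ˢ X ×ˢ X,
          2 * K * (cosetCount X G (y.1 - y.2.2) y.2.1 : ℝ) := by
        rw [Finset.mul_sum]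
      _ ≤ ∑ y ∈ X ×ˢ X ×ˢ X, (S.card : ℝ) := Finset.sum_le_sum fun y _ => (hcon _ _).le
      _ = _ := by rw [Finset.sum_const, Finset.card_product, Finset.card_product, nsmul_eq_mul]; push_cast; ring
  have h4 : ((∑ z ∈ S, En X z : ℕ) : ℝ) ≤ S.card * (X.card : ℝ) ^ 2 +
     ((((X ×ˢ X) ×ˢ (X ×ˢ X)).filter fun p => p.1.2 ≠ p.2.2 ∧
        ∃ w ∈ (G : Set F), p.1.1 = w * (p.1.2 - p.2.2) + p.2.1).card : ℝ) := by
    exact_mod_cast hsum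
  have h5 : K * ((∑ z ∈ S, En X z : ℕ) : ℝ) ≤ K * (S.card * (X.card : ℝ) ^ 2 +
     ((((X ×ˢ X) ×ˢ (X ×ˢ X)).filter fun p => p.1.2 ≠ p.2.2 ∧
        ∃ w ∈ (G : Set F), p.1.1 = w * (p.1.2 - p.2.2) + p.2.1).card : ℝ)) := by gcongr
  have h6 : (2 * K) * (S.card * (X.card : ℝ) ^ 2) < X.card * (S.card * (X.card : ℝ) ^ 2) := by
    gcongr
  nlinarith

theorem abstract_thm [Fintype F] (X S : Finset F) (K : ℝ) (hX : X.Nonempty) (hK : 1 ≤ K)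
    (h0 : (0 : F) ∈ S) (h1 : (1 : F) ∈ S)
    (hS : ∀ s ∈ S, ((X - dil s X).card : ℝ) ≤ K * X.card) :
    (X.card : ℝ) ≤ 2 ^ 17 * K ^ 9 ∨ (S.card : ℝ) ^ 2 ≤ 2 ^ 17 * K ^ 9 * X.card ∨
    (Fintype.card F : ℝ) ≤ 2 ^ 17 * K ^ 4 * X.card ∨
    ∃ G : Subfield F, G ≠ ⊤ ∧ (∃ c d : F, (S.card : ℝ) ≤
      2 * K * (cosetCount X G c d : ℝ)) ∧
      (Nat.card G : ℝ) ≤ 2 ^ 17 * K ^ 4 * X.card := by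
  have hXp : (0:ℝ) < X.card := by exact_mod_cast hX.card_pos
  have hq := D_quot X S K hX hK hS
  have h41 : (1:ℝ) ≤ (4 * K) ^ 4 := one_le_pow₀ (by linarith)
  have h49 : K ^ 4 ≤ K ^ 9 := pow_le_pow_right₀ hK (by norm_num)
  have h19 : K ≤ K ^ 9 := le_self_pow₀ hK (by norm_num)
  have hK4 : 0 ≤ K ^ 4 := by positivity
  have hK9 : 0 ≤ K ^ 9 := by positivity
  have hfin : ∀ r : F, r ∉ quotSet S →
      (∀ t ∈ S, ∀ t' ∈ S, ((X - dil (t + r * t') X).card : ℝ) ≤ 2 ^ 16 * K ^ 9 * X.card) →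
      (X.card : ℝ) ≤ 2 ^ 17 * K ^ 9 ∨ (S.card : ℝ) ^ 2 ≤ 2 ^ 17 * K ^ 9 * X.card := by
    intro r hr h
    rcases growth X S _ hX ⟨1, h1⟩ r hr h with h | h
    · left; linarith
    · right; linarith
  rcases pivot S h0 h1 with ⟨r, hr, hr'⟩ | ⟨s, hs, r, hr, hr'⟩ | ⟨G, hSG, hGR⟩
  · rcases hfin (1 + r) hr' (by
      intro t ht t' ht'
      have ha := D_mul X r t' _ _ hK hX (hq r hr) (hS t' ht')
      have hb := D_sum X t t' (r * t') K _ hX hK (hS 1 h1) (hS t ht) (hS t' ht') ha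
      have e : t + (1 + r) * t' = t + t' + r * t' := by ring
      rw [e]
      refine hb.trans ?_
      have : (3 * K) ^ 4 * ((4 * K) ^ 4 * K) = 20736 * K ^ 9 := by ring
      rw [this]
      gcongr
      norm_num) with h | h
    · exact Or.inl h
    · exact Or.inr (Or.inl h)
  · rcases hfin (s * r) hr' (by
      intro t ht t' ht'
      have ha := D_mul X (s * r) t' _ _ hK hX (D_mul X s r _ _ h41 hX (hS s hs) (hq r hr)) (hS t' ht')
      have e : t + (s * r) * t' = t + s * r * t' := by ring
      -- use the three-term bound with a vanishing second dilate
      have hc2 : ((({1, t} : Finset F)).card : ℝ) ≤ 2 := by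
        exact_mod_cast Finset.card_le_two
      have h := D_ratio X {1, t} K hX (fun s hs => by
        simp only [Finset.mem_insert, Finset.mem_singleton] at hs
        rcases hs with rfl | rfl <;> apply hS <;> assumption) 1 2 2 hc2 (by linarith)
      have key : ∀ t₀ ∈ ({1, t} : Finset F), ∀ c ∈ X,
          t₀ * c ∈ ({1, t} : Finset F).biUnion fun s => dil s X := fun t ht c hc =>
        Finset.mem_biUnion.2 ⟨t, ht, mem_dil.2 ⟨c, hc, rfl⟩⟩
      have hYX : (((X - dil t X) - X).card : ℝ) ≤ (2 * K) ^ 3 * X.card := by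
        refine le_trans ?_ h
        norm_cast
        apply Finset.card_le_card
        intro y hy
        obtain ⟨_, hy1, x', hx', rfl⟩ := Finset.mem_sub.1 hy
        obtain ⟨x, hx, _, hc', rfl⟩ := Finset.mem_sub.1 hy1
        obtain ⟨c, hc, rfl⟩ := mem_dil.1 hc'
        have e : x - t * c - x' = 1 * x - (t * c + 1 * x') := by ring
        rw [e, one_nsmul, two_nsmul]
        exact Finset.sub_mem_sub (key 1 (by simp) x hx)
          (Finset.add_mem_add (key t (by simp) c hc) (key 1 (by simp) x' hx'))
      have hsub : X - dil (t + s * r * t') X ⊆ (X - dil t X) - dil (s * r * t') X := by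
        intro y hy
        obtain ⟨x, hx, _, hb', rfl⟩ := Finset.mem_sub.1 hy
        obtain ⟨b, hb, rfl⟩ := mem_dil.1 hb'
        have e : x - (t + s * r * t') * b = x - t * b - s * r * t' * b := by ring
        rw [e]
        exact Finset.sub_mem_sub (Finset.sub_mem_sub hx (mem_dil.2 ⟨b, hb, rfl⟩))
          (mem_dil.2 ⟨b, hb, rfl⟩)
      have h3 : ((X - dil (t + s * r * t') X).card : ℝ) ≤
          (((X - dil t X) - dil (s * r * t') X).card : ℝ) := by
        exact_mod_cast Finset.card_le_card hsub
      have h4 := tri (X - dil t X) X (dil (s * r * t') X)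
      have h5 : (((X - dil t X) - X).card : ℝ) * ((X - dil (s * r * t') X).card : ℝ)
          ≤ ((2 * K) ^ 3 * X.card) * (K * (4 * K) ^ 4 * K * X.card) := by gcongr
      have h6 : (((X - dil t X) - dil (s * r * t') X).card : ℝ) * X.card
          ≤ (2 ^ 16 * K ^ 9 * X.card) * X.card := by
        have e2 : ((2 * K) ^ 3 * X.card) * (K * (4 * K) ^ 4 * K * X.card)
          = 2048 * (K ^ 9 * X.card * X.card) := by ring
        have e3 : (0:ℝ) ≤ K ^ 9 * X.card * X.card := by positivity
        nlinarith
      exact h3.trans (le_of_mul_le_mul_right h6 hXp)) with h | h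
    · exact Or.inl h
    · exact Or.inr (Or.inl h)
  · have hGfin : (G : Set F).Finite := Set.toFinite _
    have hex := exists_large X hGfin.toFinset hX ⟨1, by simp [G.one_mem]⟩ ((4 * K) ^ 4)
      (fun z hz => hq z (hGR z (by simpa using hz)))
    have hcard : (hGfin.toFinset.card : ℝ) = (Nat.card G : ℝ) := by
      have : Nat.card G = (G : Set F).ncard := rfl
      rw [this, Set.ncard_eq_toFinset_card _ hGfin]
    rw [hcard] at hex
    have e4 : 2 * (4 * K) ^ 4 = 512 * K ^ 4 := by ring
    rw [e4] at hex
    rcases hex with hex | hex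
    · left; nlinarith
    · have hGc : (Nat.card G : ℝ) ≤ 2 ^ 17 * K ^ 4 * X.card := by
        refine hex.trans ?_
        gcongr
        norm_num
      by_cases hT : G = ⊤
      · right; right; left
        have : Nat.card G = Fintype.card F := by
          subst hT
          rw [← Nat.card_eq_fintype_card]
          exact Nat.card_congr (Subfield.topEquiv (K := F)).toEquiv
        rw [this] at hGc
        exact hGc
      · by_cases hbig : 2 * K < X.card
        · right; right; right
          exact ⟨G, hT, subfield_dense X S K hX hK h1 hS G hSG hbig, hGc⟩
        · left; nlinarith


set_option linter.unusedSectionVars false in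
lemma graph_lemma (A : Finset F) (E : F → F → Prop) [∀ x y, Decidable (E x y)] (δ : ℝ) (hδ : 0 < δ) (hA : A.Nonempty)
    (h : δ * (A.card : ℝ) ^ 2 ≤ ∑ y ∈ A, ((A.filter fun x => E x y).card : ℝ)) :
    ∃ y ∈ A, ∃ N : Finset F, N = (A.filter fun x => E x y) ∧ δ * A.card / 2 ≤ (N.card : ℝ) ∧
      ∃ X ⊆ N, (N.card : ℝ) / 2 ≤ X.card ∧ ∀ x ∈ X, ∀ x' ∈ X,
        (N.card : ℝ) / 2 ≤ ((N.filter fun z =>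
          δ ^ 2 / 32 * A.card ≤ ((A.filter fun y => E x y ∧ E z y).card : ℝ) ∧
          δ ^ 2 / 32 * A.card ≤ ((A.filter fun y => E x' y ∧ E z y).card : ℝ)).card : ℝ) := by
  have ha : (0:ℝ) < A.card := by exact_mod_cast hA.card_pos
  set a : ℝ := (A.card : ℝ) with hadef
  set N : F → Finset F := fun y => A.filter fun x => E x y with hN
  set bad : F → F → Prop := fun x z =>
    ((A.filter fun y => E x y ∧ E z y).card : ℝ) < δ ^ 2 / 32 * a with hbad
  set bd : F → ℝ := fun y => (((N y ×ˢ N y).filter fun p => bad p.1 p.2).card : ℝ) with hbd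
  have h1 : δ ^ 2 * a ^ 3 ≤ ∑ y ∈ A, ((N y).card : ℝ) ^ 2 := by
    have e := sq_sum_le_card_mul_sum_sq (s := A) (f := fun y => ((N y).card : ℝ))
    have e2 : (δ * a ^ 2) ^ 2 ≤ (∑ y ∈ A, ((N y).card : ℝ)) ^ 2 := by
      gcongr
    have e3 : a * (δ ^ 2 * a ^ 3) ≤ a * ∑ y ∈ A, ((N y).card : ℝ) ^ 2 := by
      calc a * (δ ^ 2 * a ^ 3) = (δ * a ^ 2) ^ 2 := by ring
        _ ≤ _ := e2.trans e
    exact le_of_mul_le_mul_left e3 ha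
  have h2 : ∑ y ∈ A, bd y ≤ δ ^ 2 / 32 * a ^ 3 := by
    have e1 : ∀ y ∈ A, bd y = ∑ p ∈ (A ×ˢ A).filter (fun p => bad p.1 p.2),
        (if E p.1 y ∧ E p.2 y then (1:ℝ) else 0) := by
      intro y hy
      rw [Finset.sum_boole]
      simp only [hbd]
      congr 2
      ext p
      simp only [hN, Finset.mem_filter, Finset.mem_product]
      tauto
    rw [Finset.sum_congr rfl e1, Finset.sum_comm]
    have e2 : ∀ p ∈ (A ×ˢ A).filter (fun p => bad p.1 p.2),
        ∑ y ∈ A, (if E p.1 y ∧ E p.2 y then (1:ℝ) else 0) ≤ δ ^ 2 / 32 * a := by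
      intro p hp
      rw [Finset.sum_boole]
      exact le_of_lt (Finset.mem_filter.1 hp).2
    refine (Finset.sum_le_card_nsmul _ _ _ e2).trans ?_
    rw [nsmul_eq_mul]
    have e3 : (((A ×ˢ A).filter (fun p => bad p.1 p.2)).card : ℝ) ≤ a * a := by
      have := Finset.card_filter_le (A ×ˢ A) (fun p => bad p.1 p.2)
      rw [Finset.card_product] at this
      show _ ≤ (A.card : ℝ) * (A.card : ℝ)
      exact_mod_cast this
    calc _ ≤ (a * a) * (δ ^ 2 / 32 * a) := by gcongr
      _ = _ := by ring
  have h3 : ∑ y ∈ A, (δ ^ 2 * a ^ 2 / 2) ≤ ∑ y ∈ A, (((N y).card : ℝ) ^ 2 - 16 * bd y) := by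
    rw [Finset.sum_sub_distrib, ← Finset.mul_sum, Finset.sum_const, nsmul_eq_mul]
    rw [← hadef]
    nlinarith
  obtain ⟨y, hy, hyy⟩ := Finset.exists_le_of_sum_le hA h3
  have hbd0 : 0 ≤ bd y := by simp only [hbd]; positivity
  have hn0 : (0:ℝ) ≤ (N y).card := by positivity
  have hNl : δ * a / 2 ≤ ((N y).card : ℝ) := by
    apply le_of_sq_le_sq _ hn0
    nlinarith [sq_nonneg (δ * a)]
  have hNp : (0:ℝ) < (N y).card := lt_of_lt_of_le (by positivity) hNl
  have hbdl : bd y ≤ ((N y).card : ℝ) ^ 2 / 16 := by nlinarith [sq_nonneg (δ * a)]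
  refine ⟨y, hy, N y, rfl, hNl, (N y).filter (fun x =>
    (((N y).filter fun z => bad x z).card : ℝ) ≤ (N y).card / 4), Finset.filter_subset _ _, ?_, ?_⟩
  · set Z := (N y).filter (fun x =>
      ¬ ((((N y).filter fun z => bad x z).card : ℝ) ≤ (N y).card / 4)) with hZ
    have e1 := Finset.card_filter_add_card_filter_not (s := N y) (fun x =>
      (((N y).filter fun z => bad x z).card : ℝ) ≤ (N y).card / 4)
    have e2 : bd y = ∑ x ∈ N y, (((N y).filter fun z => bad x z).card : ℝ) := by
      simp only [hbd]
      rw [← Nat.cast_sum]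
      congr 1
      rw [Finset.card_filter, Finset.sum_product]
      apply Finset.sum_congr rfl
      intro x hx
      rw [Finset.card_filter]
    have e3 : (Z.card : ℝ) * ((N y).card / 4) ≤ bd y := by
      rw [e2, ← nsmul_eq_mul]
      refine le_trans ?_ (Finset.sum_le_sum_of_subset_of_nonneg (Finset.filter_subset _ _ : Z ⊆ N y)
        (fun _ _ _ => by positivity))
      apply Finset.card_nsmul_le_sum
      intro x hx
      exact le_of_lt (not_le.1 (Finset.mem_filter.1 hx).2)
    have e4 : (Z.card : ℝ) ≤ (N y).card / 4 := by
      have : (Z.card : ℝ) * ((N y).card / 4) ≤ ((N y).card / 4) * ((N y).card / 4) := by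
        nlinarith
      exact le_of_mul_le_mul_right this (by positivity)
    have e5 : ((((N y).filter (fun x =>
      (((N y).filter fun z => bad x z).card : ℝ) ≤ (N y).card / 4)).card : ℝ)) + Z.card
        = (N y).card := by exact_mod_cast e1
    linarith
  · intro x hx x' hx'
    have e1 := (Finset.mem_filter.1 hx).2
    have e2 := (Finset.mem_filter.1 hx').2
    have hsub : N y ⊆ ((N y).filter fun z =>
          δ ^ 2 / 32 * a ≤ ((A.filter fun y => E x y ∧ E z y).card : ℝ) ∧
          δ ^ 2 / 32 * a ≤ ((A.filter fun y => E x' y ∧ E z y).card : ℝ)) ∪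
          ((N y).filter fun z => bad x z) ∪ ((N y).filter fun z => bad x' z) := by
      intro z hz
      simp only [Finset.mem_union, Finset.mem_filter, hz, true_and, hbad]
      by_cases k1 : δ ^ 2 / 32 * a ≤ ((A.filter fun y => E x y ∧ E z y).card : ℝ)
      · by_cases k2 : δ ^ 2 / 32 * a ≤ ((A.filter fun y => E x' y ∧ E z y).card : ℝ)
        · exact Or.inl (Or.inl ⟨k1, k2⟩)
        · exact Or.inr (not_le.1 k2)
      · exact Or.inl (Or.inr (not_le.1 k1))
    have e3 := (Finset.card_le_card hsub).trans ((Finset.card_union_le _ _).trans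
      (Nat.add_le_add_right (Finset.card_union_le _ _) _))
    have e4 : ((N y).card : ℝ) ≤ ((N y).filter fun z =>
          δ ^ 2 / 32 * a ≤ ((A.filter fun y => E x y ∧ E z y).card : ℝ) ∧
          δ ^ 2 / 32 * a ≤ ((A.filter fun y => E x' y ∧ E z y).card : ℝ)).card +
          ((N y).filter fun z => bad x z).card + ((N y).filter fun z => bad x' z).card := by
      exact_mod_cast e3
    linarith

lemma bsg (A : Finset F) (s t : F) (hs : s ≠ 0) (ht : t ≠ 0) (δ : ℝ) (hδ : 0 < δ)
    (hA : A.Nonempty)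
    (h : δ * (A.card : ℝ) ^ 2 ≤ (((A ×ˢ A).filter fun p => s * p.1 + t * p.2 ∈ A).card : ℝ)) :
    ∃ X ⊆ A, ∃ c : F, δ * A.card / 4 ≤ (X.card : ℝ) ∧
      ((X - X).card : ℝ) * δ ^ 5 ≤ 4096 * A.card ∧ ∀ x ∈ X, s * x + c ∈ A := by
  have ha : (0:ℝ) < A.card := by exact_mod_cast hA.card_pos
  have hsum : δ * (A.card : ℝ) ^ 2 ≤
      ∑ y ∈ A, ((A.filter fun x => s * x + t * y ∈ A).card : ℝ) := by
    refine h.trans (le_of_eq ?_)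
    rw [← Nat.cast_sum]
    congr 1
    rw [Finset.card_filter, Finset.sum_product_right]
    apply Finset.sum_congr rfl
    intro x hx
    rw [Finset.card_filter]
  obtain ⟨y, hy, N, hNdef, hNl, X, hXN, hXl, hX⟩ :=
    graph_lemma A (fun x y => s * x + t * y ∈ A) δ hδ hA hsum
  have hNA : N ⊆ A := by rw [hNdef]; exact Finset.filter_subset _ _
  refine ⟨X, hXN.trans hNA, t * y, by linarith, ?_, ?_⟩
  · -- for every difference choose representatives
    have hrep : ∀ d ∈ X - X, ∃ x ∈ X, ∃ x' ∈ X, x - x' = d := fun d hd => by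
      obtain ⟨x, hx, x', hx', e⟩ := Finset.mem_sub.1 hd
      exact ⟨x, hx, x', hx', e⟩
    choose! u hu v hv huv using hrep
    set a : ℝ := (A.card : ℝ) with hadef
    set W : F → Finset (F × F × F) := fun d =>
      (N ×ˢ A ×ˢ A).filter fun w => (s * u d + t * w.2.1 ∈ A ∧ s * w.1 + t * w.2.1 ∈ A) ∧
        (s * v d + t * w.2.2 ∈ A ∧ s * w.1 + t * w.2.2 ∈ A) with hW
    have hWl : ∀ d ∈ X - X, (N.card : ℝ) / 2 * (δ ^ 2 / 32 * a) ^ 2 ≤ ((W d).card : ℝ) := by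
      intro d hd
      have e1 := hX (u d) (hu d hd) (v d) (hv d hd)
      set M := N.filter fun z =>
          δ ^ 2 / 32 * a ≤ ((A.filter fun y => s * u d + t * y ∈ A ∧ s * z + t * y ∈ A).card : ℝ) ∧
          δ ^ 2 / 32 * a ≤ ((A.filter fun y => s * v d + t * y ∈ A ∧ s * z + t * y ∈ A).card : ℝ)
        with hM
      have e2 : ((W d).card : ℝ) = ∑ z ∈ N,
          ((A.filter fun y => s * u d + t * y ∈ A ∧ s * z + t * y ∈ A).card : ℝ) *
          ((A.filter fun y => s * v d + t * y ∈ A ∧ s * z + t * y ∈ A).card : ℝ) := by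
        simp only [hW]
        rw [Finset.card_filter, Finset.sum_product]
        push_cast
        apply Finset.sum_congr rfl
        intro z hz
        rw [← Nat.cast_mul, ← Finset.card_product, ← Finset.filter_product, Finset.card_filter]
        push_cast
        rfl
      rw [e2]
      refine le_trans ?_ (Finset.sum_le_sum_of_subset_of_nonneg (Finset.filter_subset _ _ : M ⊆ N)
        (fun _ _ _ => by positivity))
      refine le_trans (b := (M.card : ℝ) * (δ ^ 2 / 32 * a) ^ 2) (by gcongr) ?_
      rw [← nsmul_eq_mul]
      apply Finset.card_nsmul_le_sum
      intro z hz
      obtain ⟨k1, k2⟩ := (Finset.mem_filter.1 hz).2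
      rw [sq]
      gcongr
    have hinj : ((X - X).sigma W).card ≤ (A ×ˢ A ×ˢ A ×ˢ A).card := by
      apply Finset.card_le_card_of_injOn (fun w : (Σ _ : F, F × F × F) =>
        (s * u w.1 + t * w.2.2.1, s * w.2.1 + t * w.2.2.1,
          s * v w.1 + t * w.2.2.2, s * w.2.1 + t * w.2.2.2))
      · rintro ⟨d, z, y1, y2⟩ hw
        simp only [Finset.coe_sigma, Set.mem_sigma_iff, Finset.mem_coe, hW, Finset.mem_filter,
          Finset.mem_product] at hw ⊢
        tauto
      · rintro ⟨d, z, y1, y2⟩ hw ⟨d', z', y1', y2'⟩ hw' heq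
        simp only [Finset.coe_sigma, Set.mem_sigma_iff, Finset.mem_coe] at hw hw'
        simp only [Prod.mk.injEq] at heq
        obtain ⟨q1, q2, q3, q4⟩ := heq
        have hd : d = d' := by
          have k1 := huv d hw.1
          have k2 := huv d' hw'.1
          apply mul_left_cancel₀ hs
          rw [← k1, ← k2]
          linear_combination q1 - q2 - q3 + q4
        subst hd
        have y1e : y1 = y1' := by
          apply mul_left_cancel₀ ht
          linear_combination q1
        have y2e : y2 = y2' := by
          apply mul_left_cancel₀ ht
          linear_combination q3
        subst y1e
        subst y2e
        have ze : z = z' := by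
          apply mul_left_cancel₀ hs
          linear_combination q2
        subst ze
        rfl
    have hfin : ((X - X).card : ℝ) * ((N.card : ℝ) / 2 * (δ ^ 2 / 32 * a) ^ 2) ≤ a ^ 4 := by
      have e1 : (((X - X).sigma W).card : ℝ) = ∑ d ∈ X - X, ((W d).card : ℝ) := by
        rw [Finset.card_sigma]; push_cast; rfl
      have e2 : (((X - X).sigma W).card : ℝ) ≤ a ^ 4 := by
        have : (((X - X).sigma W).card : ℝ) ≤ ((A ×ˢ A ×ˢ A ×ˢ A).card : ℝ) := by
          exact_mod_cast hinj
        refine this.trans (le_of_eq ?_)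
        simp only [Finset.card_product]
        push_cast
        ring
      refine le_trans ?_ e2
      rw [e1, ← nsmul_eq_mul]
      exact Finset.card_nsmul_le_sum _ _ _ hWl
    have hfin2 : ((X - X).card : ℝ) * ((δ * a / 2) / 2 * (δ ^ 2 / 32 * a) ^ 2) ≤ a ^ 4 := by
      refine le_trans ?_ hfin
      gcongr
    have hfin3 : (((X - X).card : ℝ) * δ ^ 5) * a ^ 3 ≤ (4096 * a) * a ^ 3 := by nlinarith
    exact le_of_mul_le_mul_right hfin3 (by positivity)
  · intro x hx
    have := hXN hx
    rw [hNdef] at this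
    exact (Finset.mem_filter.1 this).2


lemma popular {α ι : Type} [DecidableEq α] (P : ι → Finset α) (U : Finset α) (T : Finset ι) (κ : ℝ) (hκ : 0 ≤ κ)
    (hU : U.Nonempty) (hT : T.Nonempty) (hP : ∀ s ∈ T, P s ⊆ U)
    (h : ∀ s ∈ T, κ * (U.card : ℝ) ≤ ((P s).card : ℝ)) :
    ∃ s0 ∈ T, ∃ T' ⊆ T, κ ^ 2 / 2 * (T.card : ℝ) ≤ T'.card ∧
      ∀ s ∈ T', κ ^ 2 / 2 * (U.card : ℝ) ≤ ((P s ∩ P s0).card : ℝ) := by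
  have hu : (0:ℝ) < U.card := by exact_mod_cast hU.card_pos
  have ht : (0:ℝ) < T.card := by exact_mod_cast hT.card_pos
  set r : α → ℝ := fun p => ∑ s ∈ T, if p ∈ P s then (1:ℝ) else 0 with hr
  have hcount : ∀ Q : Finset α, Q ⊆ U → ∑ p ∈ U, (if p ∈ Q then (1:ℝ) else 0) = Q.card := by
    intro Q hQ
    rw [Finset.sum_boole]
    congr 2
    ext p
    simp only [Finset.mem_filter]
    exact ⟨fun k => k.2, fun k => ⟨hQ k, k⟩⟩
  have h1 : (T.card : ℝ) * (κ * U.card) ≤ ∑ p ∈ U, r p := by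
    simp only [hr]
    rw [Finset.sum_comm, ← nsmul_eq_mul]
    apply Finset.card_nsmul_le_sum
    intro s hs
    rw [hcount _ (hP s hs)]
    exact h s hs
  have h2 : ∑ p ∈ U, r p ^ 2 = ∑ s0 ∈ T, ∑ s ∈ T, ((P s ∩ P s0).card : ℝ) := by
    have e : ∀ p ∈ U, r p ^ 2 = ∑ s0 ∈ T, ∑ s ∈ T, if p ∈ P s ∩ P s0 then (1:ℝ) else 0 := by
      intro p hp
      rw [sq]
      simp only [hr]
      rw [Finset.sum_mul_sum]
      apply Finset.sum_congr rfl
      intro s0 hs0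
      apply Finset.sum_congr rfl
      intro s hs
      by_cases k1 : p ∈ P s <;> by_cases k2 : p ∈ P s0 <;> simp [k1, k2]
    rw [Finset.sum_congr rfl e, Finset.sum_comm]
    apply Finset.sum_congr rfl
    intro s0 hs0
    rw [Finset.sum_comm]
    apply Finset.sum_congr rfl
    intro s hs
    exact hcount _ (Finset.inter_subset_left.trans (hP s hs))
  have h3 := sq_sum_le_card_mul_sum_sq (s := U) (f := r)
  have h4 : ((T.card : ℝ) * (κ * U.card)) ^ 2 ≤ (∑ p ∈ U, r p) ^ 2 := by gcongr
  have h5 : ∑ s0 ∈ T, (T.card : ℝ) * (κ ^ 2 * U.card) ≤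
      ∑ s0 ∈ T, ∑ s ∈ T, ((P s ∩ P s0).card : ℝ) := by
    rw [← h2, Finset.sum_const, nsmul_eq_mul]
    have : (U.card : ℝ) * ((T.card : ℝ) * ((T.card : ℝ) * (κ ^ 2 * U.card))) ≤
        U.card * ∑ p ∈ U, r p ^ 2 := by
      refine le_trans (le_of_eq ?_) (h4.trans h3)
      ring
    exact le_of_mul_le_mul_left this hu
  obtain ⟨s0, hs0, hs0'⟩ := Finset.exists_le_of_sum_le hT h5
  refine ⟨s0, hs0, T.filter fun s => κ ^ 2 / 2 * (U.card : ℝ) ≤ ((P s ∩ P s0).card : ℝ),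
    Finset.filter_subset _ _, ?_, fun s hs => (Finset.mem_filter.1 hs).2⟩
  rw [← Finset.sum_filter_add_sum_filter_not T
    (fun s => κ ^ 2 / 2 * (U.card : ℝ) ≤ ((P s ∩ P s0).card : ℝ))] at hs0'
  have e1 : ∑ s ∈ T.filter (fun s => κ ^ 2 / 2 * (U.card : ℝ) ≤ ((P s ∩ P s0).card : ℝ)),
      ((P s ∩ P s0).card : ℝ) ≤
      ((T.filter (fun s => κ ^ 2 / 2 * (U.card : ℝ) ≤ ((P s ∩ P s0).card : ℝ))).card : ℝ)
        * U.card := by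
    rw [← nsmul_eq_mul]
    apply Finset.sum_le_card_nsmul
    intro s hs
    exact_mod_cast Finset.card_le_card
      (Finset.inter_subset_left.trans (hP s (Finset.mem_filter.1 hs).1))
  have e2 : ∑ s ∈ T.filter (fun s => ¬ κ ^ 2 / 2 * (U.card : ℝ) ≤ ((P s ∩ P s0).card : ℝ)),
      ((P s ∩ P s0).card : ℝ) ≤ T.card * (κ ^ 2 / 2 * U.card) := by
    refine (Finset.sum_le_card_nsmul _ _ (κ ^ 2 / 2 * U.card) ?_).trans ?_
    · intro s hs
      exact le_of_lt (not_le.1 (Finset.mem_filter.1 hs).2)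
    · rw [nsmul_eq_mul]
      gcongr
      exact Finset.filter_subset _ _
  have e3 : (κ ^ 2 / 2 * (T.card : ℝ)) * U.card ≤
      ((T.filter (fun s => κ ^ 2 / 2 * (U.card : ℝ) ≤ ((P s ∩ P s0).card : ℝ))).card : ℝ)
        * U.card := by linarith
  exact le_of_mul_le_mul_right e3 hu

lemma card_sub_symm (Z W : Finset F) : (Z - W).card = (W - Z).card := by
  rw [← Finset.card_neg, neg_sub]

lemma card_sub_tr (Z W : Finset F) (c : F) : (Z - (W + {c})).card = (Z - W).card := by
  have : Z - (W + {c}) = (Z - W) - {c} := by rw [sub_add_eq_sub_sub]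
  rw [this, Finset.sub_singleton]
  exact Finset.card_image_of_injective _ sub_left_injective

lemma common_set (A T : Finset F) (δ : ℝ) (hδ : 0 < δ) (hδ1 : δ ≤ 1) (hA : A.Nonempty)
    (hT : T.Nonempty) (h0 : ∀ s ∈ T, s ≠ 0 ∧ s ≠ 1)
    (h : ∀ s ∈ T, δ * (A.card : ℝ) ^ 2 ≤
      (((A ×ˢ A).filter fun p => s * p.1 + (1 - s) * p.2 ∈ A).card : ℝ)) :
    ∃ X ⊆ A, ∃ S : Finset F, 0 ∈ S ∧ 1 ∈ S ∧ δ * A.card / 4 ≤ (X.card : ℝ) ∧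
      δ ^ 4 / 512 * (T.card : ℝ) ≤ S.card ∧
      ∀ s ∈ S, ((X - dil s X).card : ℝ) * δ ^ 20 ≤ 2 ^ 47 * X.card := by
  have ha : (0:ℝ) < A.card := by exact_mod_cast hA.card_pos
  have hb := fun s (hs : s ∈ T) => bsg A s (1 - s) (h0 s hs).1
    (sub_ne_zero.2 (Ne.symm (h0 s hs).2)) δ hδ hA (h s hs)
  choose! X hXA c hXl hXd hc using hb
  set Y : F → Finset F := fun s => dil s (X s) + {c s} with hY
  have hYc : ∀ s ∈ T, (Y s).card = (X s).card := by
    intro s hs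
    simp only [hY, Finset.card_add_singleton]
    exact card_dil (h0 s hs).1 _
  have hYA : ∀ s ∈ T, Y s ⊆ A := by
    intro s hs y hy
    obtain ⟨w, hw, w', hw', e⟩ := Finset.mem_add.1 hy
    obtain ⟨x, hx, e'⟩ := mem_dil.1 hw
    rw [Finset.mem_singleton] at hw'
    rw [← e, ← e', hw']
    exact hc s hs x hx
  obtain ⟨s0, hs0, T', hT'T, hT'c, hT'⟩ := popular (fun s => X s ×ˢ Y s) (A ×ˢ A) T (δ ^ 2 / 16)
    (by positivity) (hA.product hA) hT
    (fun s hs => Finset.product_subset_product (hXA s hs) (hYA s hs))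
    (fun s hs => by
      rw [Finset.card_product, Finset.card_product, hYc s hs]
      push_cast
      have := hXl s hs
      calc δ ^ 2 / 16 * ((A.card : ℝ) * A.card) = (δ * A.card / 4) * (δ * A.card / 4) := by ring
        _ ≤ _ := by gcongr)
  have hs00 := (h0 s0 hs0).1
  have hXX0 : (0:ℝ) ≤ (X s0).card := by positivity
  refine ⟨X s0, hXA s0 hs0, insert 0 (insert 1 (T'.image fun s => s / s0)), by simp, by simp,
    hXl s0 hs0, ?_, ?_⟩
  · have e1 : (T'.image fun s => s / s0).card = T'.card := by
      apply Finset.card_image_of_injective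
      intro x y hxy
      exact (div_left_inj' hs00).1 hxy
    have e2 : (T'.image fun s => s / s0).card ≤
        (insert 0 (insert 1 (T'.image fun s => s / s0))).card :=
      Finset.card_le_card ((Finset.subset_insert _ _).trans (Finset.subset_insert _ _))
    rw [e1] at e2
    have e3 : (T'.card : ℝ) ≤ ((insert 0 (insert 1 (T'.image fun s => s / s0))).card : ℝ) := by
      exact_mod_cast e2
    refine le_trans (le_of_eq ?_) (hT'c.trans e3)
    ring
  · intro s hs
    have hp1 : δ ^ 20 ≤ 1 := pow_le_one₀ hδ.le hδ1
    rw [Finset.mem_insert, Finset.mem_insert] at hs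
    rcases hs with rfl | rfl | hs
    · have e : (X s0 - dil 0 (X s0)).card ≤ (X s0).card := by
        have : X s0 - dil 0 (X s0) ⊆ X s0 := by
          intro y hy
          obtain ⟨x, hx, z, hz, e⟩ := Finset.mem_sub.1 hy
          obtain ⟨w, hw, e'⟩ := mem_dil.1 hz
          rw [← e, ← e', zero_mul, sub_zero]
          exact hx
        exact Finset.card_le_card this
      have e' : ((X s0 - dil 0 (X s0)).card : ℝ) ≤ (X s0).card := by exact_mod_cast e
      calc ((X s0 - dil 0 (X s0)).card : ℝ) * δ ^ 20 ≤ (X s0).card * 1 := by gcongr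
        _ ≤ _ := by nlinarith
    · have e : dil 1 (X s0) = X s0 := by simp [dil]
      rw [e]
      have h1 := hXd s0 hs0
      have h2 := hXl s0 hs0
      have h15 : δ ^ 14 ≤ 1 := pow_le_one₀ hδ.le hδ1
      calc ((X s0 - X s0).card : ℝ) * δ ^ 20
          = (((X s0 - X s0).card : ℝ) * δ ^ 5) * δ * δ ^ 14 := by ring
        _ ≤ (4096 * A.card) * δ * 1 := by gcongr
        _ = 16384 * (δ * A.card / 4) := by ring
        _ ≤ 16384 * (X s0).card := by gcongr
        _ ≤ _ := by nlinarith
    · obtain ⟨s', hsT₂, rfl⟩ := Finset.mem_image.1 hs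
      have hsT₃ := hT'T hsT₂
      have hs'0 := (h0 s' hsT₃).1
      have hUV := hT' s' hsT₂
      simp only [Finset.product_inter_product, Finset.card_product] at hUV
      push_cast at hUV
      set U := X s' ∩ X s0 with hU
      set V := Y s' ∩ Y s0 with hV
      have t1 := tri (dil s' (X s0)) (dil s' U) (Y s0)
      have t2 := tri (dil s' U) V (Y s0)
      rw [card_dil hs'0, ← dil_sub, card_dil hs'0] at t1
      have t3 : ((X s0 - U).card : ℝ) ≤ (X s0 - X s0).card := by
        exact_mod_cast Finset.card_le_card (Finset.sub_subset_sub_left Finset.inter_subset_right)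
      have t4 : ((V - Y s0).card : ℝ) ≤ (X s0 - X s0).card := by
        have k : (V - Y s0).card ≤ (Y s0 - Y s0).card :=
          Finset.card_le_card (Finset.sub_subset_sub_right Finset.inter_subset_right)
        have k2 : (Y s0 - Y s0).card = (X s0 - X s0).card := by
          simp only [hY]
          rw [card_sub_tr, card_sub_symm, card_sub_tr, ← dil_sub, card_dil hs00]
        rw [k2] at k
        exact_mod_cast k
      have t5 : ((dil s' U - V).card : ℝ) ≤ (X s' - X s').card := by
        have k : (dil s' U - V).card ≤ (dil s' (X s') - Y s').card :=
          Finset.card_le_card (Finset.sub_subset_sub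
            (Finset.image_subset_image Finset.inter_subset_left) Finset.inter_subset_left)
        have k2 : (dil s' (X s') - Y s').card = (X s' - X s').card := by
          simp only [hY]
          rw [card_sub_tr, ← dil_sub, card_dil hs'0]
        rw [k2] at k
        exact_mod_cast k
      have t6 : ((dil s' (X s0) - Y s0).card : ℝ) = ((X s0 - dil (s' / s0) (X s0)).card : ℝ) := by
        congr 1
        simp only [hY]
        rw [card_sub_tr, card_sub_symm, ← card_dil hs00 (X s0 - dil (s' / s0) (X s0)), dil_sub,
          dil_dil, mul_div_cancel₀ _ hs00]
      rw [t6] at t1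
      set Z : ℝ := ((X s0 - dil (s' / s0) (X s0)).card : ℝ) with hZ
      set D0 : ℝ := ((X s0 - X s0).card : ℝ) with hD0
      set D1 : ℝ := ((X s' - X s').card : ℝ) with hD1
      set a : ℝ := (A.card : ℝ) with hadef
      have b0 : D0 * δ ^ 5 ≤ 4096 * a := hXd s0 hs0
      have b1 : D1 * δ ^ 5 ≤ 4096 * a := hXd s' hsT₃
      have n0 : 0 ≤ D0 := by positivity
      have n1 : 0 ≤ D1 := by positivity
      have nZ : 0 ≤ Z := by positivity
      have u1 : Z * (U.card * V.card) ≤ D0 * (D1 * D0) := by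
        calc Z * (U.card * V.card) = (Z * U.card) * V.card := by ring
          _ ≤ (((X s0 - U).card : ℝ) * (dil s' U - Y s0).card) * V.card := by gcongr
          _ = ((X s0 - U).card : ℝ) * ((dil s' U - Y s0).card * V.card) := by ring
          _ ≤ ((X s0 - U).card : ℝ) * ((dil s' U - V).card * (V - Y s0).card) := by gcongr
          _ ≤ D0 * (D1 * D0) := by gcongr
      have u2 : Z * ((δ ^ 2 / 16) ^ 2 / 2 * (a * a)) * δ ^ 15 ≤ (4096 * a) ^ 3 := by
        calc Z * ((δ ^ 2 / 16) ^ 2 / 2 * (a * a)) * δ ^ 15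
            ≤ Z * (U.card * V.card) * δ ^ 15 :=
              mul_le_mul_of_nonneg_right (mul_le_mul_of_nonneg_left hUV nZ) (by positivity)
          _ ≤ D0 * (D1 * D0) * δ ^ 15 := by gcongr
          _ = (D0 * δ ^ 5) * (D1 * δ ^ 5) * (D0 * δ ^ 5) := by ring
          _ ≤ (4096 * a) * (4096 * a) * (4096 * a) := by gcongr
          _ = _ := by ring
      have u3 : (Z * δ ^ 19) * (a * a) ≤ (2 ^ 45 * a) * (a * a) := by
        calc (Z * δ ^ 19) * (a * a) = 512 * (Z * ((δ ^ 2 / 16) ^ 2 / 2 * (a * a)) * δ ^ 15) := by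
              ring
          _ ≤ 512 * (4096 * a) ^ 3 := by linarith
          _ = _ := by ring
      have u4 : Z * δ ^ 19 ≤ 2 ^ 45 * a := le_of_mul_le_mul_right u3 (by positivity)
      have h2 := hXl s0 hs0
      calc Z * δ ^ 20 = (Z * δ ^ 19) * δ := by ring
        _ ≤ (2 ^ 45 * a) * δ := by gcongr
        _ = 2 ^ 47 * (δ * a / 4) := by ring
        _ ≤ _ := by gcongr


@[irreducible] def bigc : ℝ := 2 ^ 458

lemma bigc_ge (k : ℕ) (hk : k ≤ 458) : (2:ℝ) ^ k ≤ bigc := by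
  unfold bigc
  exact pow_le_pow_right₀ (by norm_num) hk

lemma bigc_pos : 0 < bigc := lt_of_lt_of_le (by norm_num) (bigc_ge 0 (by norm_num))

lemma finish_pow (δ c x y : ℝ) (hδ : 0 ≤ δ) (hc1 : 1 ≤ c) (hx : 0 ≤ x) (hy : 0 ≤ y) (k : ℕ)
    (hk : k ≠ 0) (hle : δ ^ k ≤ c * x ^ k) : δ ≤ c * (x + y) := by
  have e1 : δ ^ k ≤ (c * x) ^ k := by
    refine hle.trans ?_
    rw [mul_pow]
    gcongr
    exact le_self_pow₀ hc1 hk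
  have e2 : δ ≤ c * x := (pow_le_pow_iff_left₀ hδ (by positivity) hk).1 e1
  nlinarith

lemma coset_le (A X : Finset F) (C M : ℝ) (hXA : X ⊆ A) (hsub : subfieldCond A C M)
    (G : Subfield F) (hGT : G ≠ ⊤) (c d : F) :
    (cosetCount X G c d : ℝ) ≤ C * max ((Nat.card G : ℝ) ^ ((1:ℝ)/2)) M := by
  refine le_trans ?_ (hsub G hGT c d)
  unfold cosetCount
  have k : (X.filter fun x => ∃ g ∈ G, x = c * g + d) ⊆
      (A.filter fun x => ∃ g ∈ G, x = c * g + d) := Finset.filter_subset_filter _ hXA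
  exact_mod_cast Finset.card_le_card k

set_option exponentiation.threshold 1000 in
lemma core_one [Fintype F] (A T : Finset F) (δ a b q C M r w : ℝ) (hδ : 0 < δ) (hδ1 : δ ≤ 1)
    (hA : A.Nonempty)
    (hT : T.Nonempty) (h0 : ∀ s ∈ T, s ≠ 0 ∧ s ≠ 1)
    (h : ∀ s ∈ T, δ * (A.card : ℝ) ^ 2 ≤
      (((A ×ˢ A).filter fun p => s * p.1 + (1 - s) * p.2 ∈ A).card : ℝ))
    (ha : a = A.card) (hq : q = Fintype.card F) (hb : 0 < b) (hba : b ≤ a)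
    (hTb : δ * b ≤ T.card) (hC : 0 < C) (hsub : subfieldCond A C M)
    (hr : 0 ≤ r) (hw : 0 ≤ w) (hra : r ^ 191 * b ^ 2 = a) (hwa : w ^ 103 * q = a)
    (hM : M = r ^ 31 * b) :
    δ ≤ bigc * (1 + C) ^ 2 * (r + w) := by
  have hap : 0 < a := lt_of_lt_of_le hb hba
  have hqp : 0 < q := by
    rw [hq]
    exact_mod_cast Fintype.card_pos
  set c : ℝ := bigc * (1 + C) ^ 2 with hc
  have hC1 : 1 ≤ (1 + C) ^ 2 := by nlinarith
  have hc458 : (2:ℝ) ^ 458 ≤ c := by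
    rw [hc]
    exact (bigc_ge 458 le_rfl).trans (le_mul_of_one_le_right bigc_pos.le hC1)
  have hc1 : 1 ≤ c := le_trans (one_le_pow₀ (by norm_num)) hc458
  have hc0 : 0 ≤ c := zero_le_one.trans hc1
  have hbp := bigc_pos
  have finish_r : ∀ k : ℕ, k ≠ 0 → δ ^ k ≤ c * r ^ k → δ ≤ c * (r + w) :=
    fun k hk hle => finish_pow δ c r w hδ.le hc1 hr hw k hk hle
  have finish_w : ∀ k : ℕ, k ≠ 0 → δ ^ k ≤ c * w ^ k → δ ≤ c * (r + w) :=
    fun k hk hle => by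
      rw [add_comm]
      exact finish_pow δ c w r hδ.le hc1 hw hr k hk hle
  have fin191 : b ^ 2 * δ ^ 191 ≤ c * a → δ ≤ c * (r + w) := by
    intro hle
    apply finish_r 191 (by norm_num)
    have : b ^ 2 * δ ^ 191 ≤ b ^ 2 * (c * r ^ 191) := by
      refine hle.trans (le_of_eq ?_)
      rw [← hra]
      ring
    exact le_of_mul_le_mul_left this (by positivity)
  obtain ⟨X, hXA, S, hS0, hS1, hXl, hSl, hS⟩ := common_set A T δ hδ hδ1 hA hT h0 h
  rw [← ha] at hXl
  have hXp : (0:ℝ) < X.card := lt_of_lt_of_le (by positivity) hXl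
  have hXa : (X.card : ℝ) ≤ a := by
    rw [ha]; exact_mod_cast Finset.card_le_card hXA
  have hXne : X.Nonempty := by
    rw [← Finset.card_pos]; exact_mod_cast hXp
  set K : ℝ := 2 ^ 47 / δ ^ 20 with hK
  have hKδ : K * δ ^ 20 = 2 ^ 47 := by
    rw [hK]; field_simp
  have hK1 : 1 ≤ K := by
    rw [hK, le_div_iff₀ (by positivity)]
    have : δ ^ 20 ≤ 1 := pow_le_one₀ hδ.le hδ1
    linarith
  have hK0 : 0 ≤ K := by linarith
  have hSK : ∀ s ∈ S, ((X - dil s X).card : ℝ) ≤ K * X.card := by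
    intro s hs
    have := hS s hs
    rw [hK, div_mul_eq_mul_div, le_div_iff₀ (by positivity)]
    exact this
  set n : ℝ := (S.card : ℝ) with hn
  have hnl : δ ^ 5 * b ≤ 512 * n := by
    have : δ ^ 4 / 512 * (δ * b) ≤ n := le_trans (by gcongr) hSl
    linarith only [this]
  have hn0 : 0 ≤ n := by positivity
  have hnl2 : δ ^ 10 * b ^ 2 ≤ 2 ^ 18 * n ^ 2 := by
    have : (δ ^ 5 * b) ^ 2 ≤ (512 * n) ^ 2 := by gcongr
    calc δ ^ 10 * b ^ 2 = (δ ^ 5 * b) ^ 2 := by ring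
      _ ≤ _ := this
      _ = _ := by ring
  have hK9 : K ^ 9 * δ ^ 180 = 2 ^ 423 := by
    calc K ^ 9 * δ ^ 180 = (K * δ ^ 20) ^ 9 := by ring
      _ = _ := by rw [hKδ]; norm_num
  have hK4 : K ^ 4 * δ ^ 80 = 2 ^ 188 := by
    calc K ^ 4 * δ ^ 80 = (K * δ ^ 20) ^ 4 := by ring
      _ = _ := by rw [hKδ]; norm_num
  have hK6 : K ^ 6 * δ ^ 120 = 2 ^ 282 := by
    calc K ^ 6 * δ ^ 120 = (K * δ ^ 20) ^ 6 := by ring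
      _ = _ := by rw [hKδ]; norm_num
  rcases abstract_thm X S K hXne hK1 hS0 hS1 hSK with h1 | h2 | h3 | ⟨G, hGT, ⟨cc, dd, hm⟩, hG⟩
  · apply fin191
    have e1 : a * δ ^ 181 ≤ 2 ^ 442 := by
      calc a * δ ^ 181 = 4 * (δ * a / 4) * δ ^ 180 := by ring
        _ ≤ 4 * (2 ^ 17 * K ^ 9) * δ ^ 180 := by gcongr; linarith only [hXl, h1]
        _ = 2 ^ 19 * (K ^ 9 * δ ^ 180) := by ring
        _ = 2 ^ 442 := by rw [hK9]; norm_num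
    have e2 : δ ^ 191 ≤ δ ^ 181 := pow_le_pow_of_le_one hδ.le hδ1 (by norm_num)
    calc b ^ 2 * δ ^ 191 ≤ (a * a) * δ ^ 181 := by rw [sq]; gcongr
      _ = a * (a * δ ^ 181) := by ring
      _ ≤ a * 2 ^ 442 := by gcongr
      _ ≤ a * c := by
        gcongr
        refine le_trans ?_ hc458
        exact pow_le_pow_right₀ (by norm_num) (by norm_num)
      _ = c * a := by ring
  · apply fin191
    have e2 : δ ^ 191 ≤ δ ^ 190 := pow_le_pow_of_le_one hδ.le hδ1 (by norm_num)
    calc b ^ 2 * δ ^ 191 ≤ b ^ 2 * δ ^ 190 := by gcongr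
      _ = (δ ^ 10 * b ^ 2) * δ ^ 180 := by ring
      _ ≤ (2 ^ 18 * n ^ 2) * δ ^ 180 := by gcongr
      _ ≤ (2 ^ 18 * (2 ^ 17 * K ^ 9 * X.card)) * δ ^ 180 := by gcongr
      _ = 2 ^ 35 * (K ^ 9 * δ ^ 180) * X.card := by ring
      _ = 2 ^ 458 * X.card := by rw [hK9]; norm_num
      _ ≤ c * a := mul_le_mul hc458 hXa hXp.le hc0
  · apply finish_w 103 (by norm_num)
    rw [← hq] at h3
    have e2 : δ ^ 103 ≤ δ ^ 80 := pow_le_pow_of_le_one hδ.le hδ1 (by norm_num)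
    have : q * δ ^ 103 ≤ q * (c * w ^ 103) := by
      calc q * δ ^ 103 ≤ q * δ ^ 80 := by gcongr
        _ ≤ (2 ^ 17 * K ^ 4 * X.card) * δ ^ 80 := by gcongr
        _ = 2 ^ 17 * (K ^ 4 * δ ^ 80) * X.card := by ring
        _ = 2 ^ 205 * X.card := by rw [hK4]; norm_num
        _ ≤ c * a := by
          refine mul_le_mul ?_ hXa hXp.le hc0
          refine le_trans ?_ hc458
          exact pow_le_pow_right₀ (by norm_num) (by norm_num)
        _ = q * (c * w ^ 103) := by rw [← hwa]; ring
    exact le_of_mul_le_mul_left this hqp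
  · have hmA : (cosetCount X G cc dd : ℝ) ≤ C * max ((Nat.card G : ℝ) ^ ((1:ℝ)/2)) M :=
      coset_le A X C M hXA hsub G hGT cc dd
    have hnm : n ≤ 2 * K * (C * max ((Nat.card G : ℝ) ^ ((1:ℝ)/2)) M) := by
      refine hm.trans ?_
      gcongr
    rcases le_total M ((Nat.card G : ℝ) ^ ((1:ℝ)/2)) with hle | hle
    · rw [max_eq_left hle] at hnm
      apply fin191
      have e2 : δ ^ 191 ≤ δ ^ 130 := pow_le_pow_of_le_one hδ.le hδ1 (by norm_num)
      have e3 : ((Nat.card G : ℝ) ^ ((1:ℝ)/2)) ^ 2 = Nat.card G := by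
        rw [← Real.rpow_natCast, ← Real.rpow_mul (by positivity)]
        norm_num
      have e4 : n ^ 2 ≤ 2 ^ 19 * K ^ 6 * C ^ 2 * X.card := by
        calc n ^ 2 ≤ (2 * K * (C * (Nat.card G : ℝ) ^ ((1:ℝ)/2))) ^ 2 := by gcongr
          _ = 4 * K ^ 2 * C ^ 2 * ((Nat.card G : ℝ) ^ ((1:ℝ)/2)) ^ 2 := by ring
          _ = 4 * K ^ 2 * C ^ 2 * Nat.card G := by rw [e3]
          _ ≤ 4 * K ^ 2 * C ^ 2 * (2 ^ 17 * K ^ 4 * X.card) := by gcongr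
          _ = _ := by ring
      calc b ^ 2 * δ ^ 191 ≤ b ^ 2 * δ ^ 130 := by gcongr
        _ = (δ ^ 10 * b ^ 2) * δ ^ 120 := by ring
        _ ≤ (2 ^ 18 * n ^ 2) * δ ^ 120 := by gcongr
        _ ≤ (2 ^ 18 * (2 ^ 19 * K ^ 6 * C ^ 2 * X.card)) * δ ^ 120 := by gcongr
        _ = 2 ^ 37 * (K ^ 6 * δ ^ 120) * C ^ 2 * X.card := by ring
        _ = 2 ^ 319 * C ^ 2 * X.card := by rw [hK6]; norm_num
        _ ≤ bigc * (1 + C) ^ 2 * a := by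
          gcongr
          · exact bigc_ge 319 (by norm_num)
          · exact le_add_of_nonneg_left zero_le_one
        _ = c * a := by rw [hc]
    · rw [max_eq_right hle] at hnm
      apply finish_r 31 (by norm_num)
      have e2 : δ ^ 31 ≤ δ ^ 25 := pow_le_pow_of_le_one hδ.le hδ1 (by norm_num)
      have hCC : C ≤ (1 + C) ^ 2 := by nlinarith only [hC]
      have : b * δ ^ 31 ≤ b * (c * r ^ 31) := by
        calc b * δ ^ 31 ≤ b * δ ^ 25 := by gcongr
          _ = (δ ^ 5 * b) * δ ^ 20 := by ring
          _ ≤ (512 * n) * δ ^ 20 := by gcongr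
          _ ≤ (512 * (2 * K * (C * M))) * δ ^ 20 := by gcongr
          _ = 1024 * (K * δ ^ 20) * C * M := by ring
          _ = 2 ^ 57 * C * M := by rw [hKδ]; norm_num
          _ = 2 ^ 57 * C * (r ^ 31 * b) := by rw [hM]
          _ ≤ bigc * (1 + C) ^ 2 * (r ^ 31 * b) := by
            gcongr
            exact bigc_ge 57 (by norm_num)
          _ = b * (c * r ^ 31) := by rw [hc]; ring
      exact le_of_mul_le_mul_left this hb

def cnt (A : Finset F) (s : F) : ℕ :=
  ((A ×ˢ A).filter fun p => s * p.1 + (1 - s) * p.2 ∈ A).card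

def rest (B : Finset F) (p : F × F) : Finset F := B.filter fun z => z ≠ p.1 ∧ z ≠ p.2

def trip (A B : Finset F) : ℕ :=
  ∑ p ∈ B.offDiag, ∑ z ∈ rest B p, cnt A ((p.2 - z) / (p.2 - p.1))

lemma cnt_le (A : Finset F) (s : F) : (cnt A s : ℝ) ≤ (A.card : ℝ) ^ 2 := by
  have := Finset.card_filter_le (A ×ˢ A) (fun p => s * p.1 + (1 - s) * p.2 ∈ A)
  rw [Finset.card_product] at this
  rw [sq]
  exact_mod_cast this

lemma core [Fintype F] (A B : Finset F) (a b q C M r w : ℝ)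
    (hB : B.Nonempty)
    (ha : a = A.card) (hbB : b = B.card) (hq : q = Fintype.card F) (hba : b ≤ a)
    (hC : 0 < C) (hsub : subfieldCond A C M)
    (hr : 0 ≤ r) (hw : 0 ≤ w) (hra : r ^ 191 * b ^ 2 = a) (hwa : w ^ 103 * q = a)
    (hM : M = r ^ 31 * b) :
    (trip A B : ℝ) ≤ 2 * bigc * (1 + C) ^ 2 * (a ^ 2 * b ^ 3) * (r + w) := by
  have hb : 0 < b := by rw [hbB]; exact_mod_cast hB.card_pos
  have hap : 0 < a := lt_of_lt_of_le hb hba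
  have hA : A.Nonempty := by
    rw [← Finset.card_pos]
    rw [ha] at hap
    exact_mod_cast hap
  by_cases hz : trip A B = 0
  · have := bigc_pos
    rw [hz]; push_cast
    exact mul_nonneg (mul_nonneg (mul_nonneg (mul_nonneg zero_le_two this.le) (sq_nonneg _))
      (mul_nonneg (sq_nonneg _) (pow_nonneg hb.le 3))) (add_nonneg hr hw)
  have htp : (0:ℝ) < trip A B := by exact_mod_cast Nat.pos_of_ne_zero hz
  set δ : ℝ := (trip A B : ℝ) / (2 * a ^ 2 * b ^ 3) with hδdef
  have hδ : 0 < δ := by positivity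
  have htδ : (trip A B : ℝ) = δ * (2 * a ^ 2 * b ^ 3) := by rw [hδdef]; field_simp
  have hoff : (B.offDiag.card : ℝ) ≤ b ^ 2 := by
    have : B.offDiag.card ≤ B.card * B.card := by rw [Finset.offDiag_card]; omega
    rw [hbB, sq]; exact_mod_cast this
  have hrest : ∀ p, ((rest B p).card : ℝ) ≤ b := by
    intro p; rw [hbB]; exact_mod_cast Finset.card_filter_le _ _
  have htle : (trip A B : ℝ) ≤ b ^ 2 * (b * a ^ 2) := by
    unfold trip
    push_cast
    refine (Finset.sum_le_card_nsmul _ _ (b * a ^ 2) ?_).trans ?_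
    · intro p hp
      refine (Finset.sum_le_card_nsmul _ _ (a ^ 2) ?_).trans ?_
      · intro z hz'
        rw [ha]; exact cnt_le _ _
      · rw [nsmul_eq_mul]; gcongr; exact hrest p
    · rw [nsmul_eq_mul]; gcongr
  have hδ1 : δ ≤ 1 := by
    rw [hδdef, div_le_one (by positivity)]
    nlinarith [show 0 < a ^ 2 * b ^ 3 by positivity]
  have hne : B.offDiag.Nonempty := by
    rw [Finset.nonempty_iff_ne_empty]
    intro he
    apply hz
    unfold trip
    rw [he]
    simp
  have hpig : ∑ p ∈ B.offDiag, (2 * δ * a ^ 2 * b) ≤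
      ∑ p ∈ B.offDiag, ∑ z ∈ rest B p, (cnt A ((p.2 - z) / (p.2 - p.1)) : ℝ) := by
    have e : ∑ p ∈ B.offDiag, ∑ z ∈ rest B p, (cnt A ((p.2 - z) / (p.2 - p.1)) : ℝ) =
        (trip A B : ℝ) := by unfold trip; push_cast; rfl
    rw [e, htδ, Finset.sum_const, nsmul_eq_mul]
    calc (B.offDiag.card : ℝ) * (2 * δ * a ^ 2 * b) ≤ b ^ 2 * (2 * δ * a ^ 2 * b) := by gcongr
      _ = _ := by ring
  obtain ⟨p, hp, hpp⟩ := Finset.exists_le_of_sum_le hne hpig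
  have hp12 : p.1 ≠ p.2 := (Finset.mem_offDiag.1 hp).2.2
  have hp21 : p.2 - p.1 ≠ 0 := sub_ne_zero.2 (Ne.symm hp12)
  set B1 := (rest B p).filter fun z => δ * a ^ 2 ≤ (cnt A ((p.2 - z) / (p.2 - p.1)) : ℝ) with hB1
  have hB1c : δ * b ≤ B1.card := by
    rw [← Finset.sum_filter_add_sum_filter_not (rest B p)
      (fun z => δ * a ^ 2 ≤ (cnt A ((p.2 - z) / (p.2 - p.1)) : ℝ))] at hpp
    have e1 : ∑ z ∈ (rest B p).filter
        (fun z => δ * a ^ 2 ≤ (cnt A ((p.2 - z) / (p.2 - p.1)) : ℝ)),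
        (cnt A ((p.2 - z) / (p.2 - p.1)) : ℝ) ≤ B1.card * a ^ 2 := by
      rw [← nsmul_eq_mul]
      apply Finset.sum_le_card_nsmul
      intro z _
      rw [ha]; exact cnt_le _ _
    have e2 : ∑ z ∈ (rest B p).filter
        (fun z => ¬ δ * a ^ 2 ≤ (cnt A ((p.2 - z) / (p.2 - p.1)) : ℝ)),
        (cnt A ((p.2 - z) / (p.2 - p.1)) : ℝ) ≤ b * (δ * a ^ 2) := by
      refine (Finset.sum_le_card_nsmul _ _ (δ * a ^ 2) ?_).trans ?_
      · intro z hz'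
        exact le_of_lt (not_le.1 (Finset.mem_filter.1 hz').2)
      · rw [nsmul_eq_mul]
        gcongr
        refine le_trans ?_ (hrest p)
        exact_mod_cast Finset.card_filter_le _ _
    have e3 : (δ * b) * a ^ 2 ≤ B1.card * a ^ 2 := by linarith
    exact le_of_mul_le_mul_right e3 (by positivity)
  have hinj : Function.Injective (fun z : F => (p.2 - z) / (p.2 - p.1)) := by
    intro x y hxy
    have := (div_left_inj' hp21).1 hxy
    exact sub_right_injective this
  have hTc : (B1.image (fun z : F => (p.2 - z) / (p.2 - p.1))).card = B1.card :=
    Finset.card_image_of_injective _ hinj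
  have hB1p : (0:ℝ) < B1.card := lt_of_lt_of_le (by positivity) hB1c
  have hB1ne : B1.Nonempty := by rw [← Finset.card_pos]; exact_mod_cast hB1p
  have hfin := core_one A (B1.image (fun z : F => (p.2 - z) / (p.2 - p.1))) δ a b q C M r w hδ hδ1
    hA (hB1ne.image _) (by
      intro s hs
      obtain ⟨z, hz', rfl⟩ := Finset.mem_image.1 hs
      have hz2 := (Finset.mem_filter.1 (Finset.mem_filter.1 hz').1).2
      constructor
      · apply div_ne_zero _ hp21
        exact sub_ne_zero.2 (Ne.symm hz2.2)
      · intro he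
        rw [div_eq_one_iff_eq hp21] at he
        exact hz2.1 (sub_right_injective he)) (by
      intro s hs
      obtain ⟨z, hz', rfl⟩ := Finset.mem_image.1 hs
      rw [← ha]
      exact (Finset.mem_filter.1 hz').2) ha hq hb hba (by rw [hTc]; exact hB1c) hC hsub hr hw hra hwa hM
  rw [htδ]
  calc δ * (2 * a ^ 2 * b ^ 3) ≤ (bigc * (1 + C) ^ 2 * (r + w)) * (2 * a ^ 2 * b ^ 3) := by gcongr
    _ = _ := by ring


lemma inner_pow_three {ι : Type} (s : Finset ι) (f : ι → ℝ) (hf : ∀ i ∈ s, 0 ≤ f i) :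
    (∑ i ∈ s, f i) ^ 3 ≤ (s.card : ℝ) ^ 2 * ∑ i ∈ s, f i ^ 3 := by
  rcases s.eq_empty_or_nonempty with rfl | hs
  · simp
  · have h := pow_sum_div_card_le_sum_pow hf 2
    have hp : (0:ℝ) < (s.card : ℝ) ^ 2 := by
      have : (0:ℝ) < s.card := by exact_mod_cast hs.card_pos
      positivity
    rw [div_le_iff₀ hp] at h
    rw [mul_comm]
    exact h


def rows (A B : Finset F) (m : F × F) : Finset F := B.filter fun y => m.1 * y + m.2 ∈ A

set_option linter.unusedSectionVars false in
lemma triple_card (R : Finset F) (hR : 2 ≤ R.card) :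
    ∑ p ∈ R.offDiag, (rest R p).card = (R.card * R.card - R.card) * (R.card - 2) := by
  rw [← Finset.offDiag_card, ← smul_eq_mul, ← Finset.sum_const]
  apply Finset.sum_congr rfl
  intro p hp
  rw [Finset.mem_offDiag] at hp
  have e : rest R p = (R.erase p.1).erase p.2 := by
    ext z
    simp only [rest, Finset.mem_filter, Finset.mem_erase]
    tauto
  rw [e, Finset.card_erase_of_mem, Finset.card_erase_of_mem hp.1]
  · omega
  · rw [Finset.mem_erase]
    exact ⟨Ne.symm hp.2.2, hp.2.1⟩

lemma lines_trip (A B : Finset F) (M : Finset (F × F)) :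
    ∑ m ∈ M, ∑ p ∈ (rows A B m).offDiag, (rest (rows A B m) p).card ≤ trip A B := by
  have e1 : ∀ m ∈ M, ∑ p ∈ (rows A B m).offDiag, (rest (rows A B m) p).card =
      ∑ p ∈ B.offDiag, ∑ z ∈ rest B p,
        if (p.1 ∈ rows A B m ∧ p.2 ∈ rows A B m) ∧ z ∈ rows A B m then 1 else 0 := by
    intro m _
    have hd : (rows A B m).offDiag = B.offDiag.filter
        fun p => p.1 ∈ rows A B m ∧ p.2 ∈ rows A B m := by
      ext p
      simp only [rows, Finset.mem_offDiag, Finset.mem_filter]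
      tauto
    rw [hd, Finset.sum_filter]
    apply Finset.sum_congr rfl
    intro p _
    by_cases hp : p.1 ∈ rows A B m ∧ p.2 ∈ rows A B m
    · rw [if_pos hp, ← Finset.card_filter]
      refine congrArg Finset.card ?_
      ext z
      have hz : z ∈ rows A B m → z ∈ B := fun k => (Finset.mem_filter.1 k).1
      simp only [rest, Finset.mem_filter]
      tauto
    · rw [if_neg hp]
      simp only [ hp, false_and, if_false, Finset.sum_const_zero]
  rw [Finset.sum_congr rfl e1, Finset.sum_comm]
  unfold trip
  apply Finset.sum_le_sum
  intro p hp
  rw [Finset.sum_comm]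
  apply Finset.sum_le_sum
  intro z _
  rw [← Finset.card_filter]
  have hp12 : p.2 - p.1 ≠ 0 := sub_ne_zero.2 (Ne.symm (Finset.mem_offDiag.1 hp).2.2)
  unfold cnt
  apply Finset.card_le_card_of_injOn (fun m => (m.1 * p.1 + m.2, m.1 * p.2 + m.2))
  · intro m hm
    rw [Finset.mem_coe] at hm ⊢
    simp only [rows, Finset.mem_filter, Finset.mem_product] at hm ⊢
    refine ⟨⟨hm.2.1.1.2, hm.2.1.2.2⟩, ?_⟩
    have e : (p.2 - z) / (p.2 - p.1) * (m.1 * p.1 + m.2) +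
        (1 - (p.2 - z) / (p.2 - p.1)) * (m.1 * p.2 + m.2) = m.1 * z + m.2 := by
      field_simp
      ring
    rw [e]
    exact hm.2.2.2
  · rintro ⟨m, k⟩ _ ⟨m', k'⟩ _ heq
    simp only [Prod.mk.injEq] at heq
    obtain ⟨q1, q2⟩ := heq
    have hm : m = m' := by
      apply mul_right_cancel₀ hp12
      linear_combination q2 - q1
    subst hm
    have hk : k = k' := by linear_combination q1
    rw [hk]

lemma line_cases (l : Set (F × F)) (h : IsLine l) :
    (∃ c : F, l = {p : F × F | p.2 = c}) ∨ ∃ m : F × F, l = {p : F × F | p.1 = m.1 * p.2 + m.2} := by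
  obtain ⟨a, b, c, hab, rfl⟩ := h
  by_cases ha : a = 0
  · left
    have hb : b ≠ 0 := by
      intro hb
      exact hab (by rw [ha, hb])
    refine ⟨c / b, ?_⟩
    ext p
    show a * p.1 + b * p.2 = c ↔ p.2 = c / b
    rw [ha, zero_mul, zero_add, eq_div_iff hb, mul_comm]
  · right
    refine ⟨(-b / a, c / a), ?_⟩
    ext p
    show a * p.1 + b * p.2 = c ↔ p.1 = -b / a * p.2 + c / a
    constructor
    · intro e
      field_simp
      linear_combination e
    · intro e
      rw [e]
      field_simp
      ring

set_option linter.unusedSectionVars false in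
lemma incid_sum (P : Finset (F × F)) (L : Finset (Set (F × F))) :
    incidences P L = ∑ l ∈ L, (P.filter fun p => p ∈ l).card := by
  unfold incidences
  rw [Finset.card_filter, Finset.sum_product_right]
  apply Finset.sum_congr rfl
  intro l _
  rw [Finset.card_filter]

lemma rows_card (A B : Finset F) (m : F × F) (l : Set (F × F))
    (hl : l = {p : F × F | p.1 = m.1 * p.2 + m.2}) :
    ((A ×ˢ B).filter fun p => p ∈ l).card = (rows A B m).card := by
  have hmem : ∀ p : F × F, p ∈ l ↔ p.1 = m.1 * p.2 + m.2 := by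
    intro p
    rw [hl]
    rfl
  symm
  apply Finset.card_bij (fun y _ => (m.1 * y + m.2, y))
  · intro y hy
    simp only [rows, Finset.mem_filter, Finset.mem_product, hmem] at hy ⊢
    exact ⟨⟨hy.2, hy.1⟩, trivial⟩
  · intro y _ y' _ e
    exact (Prod.mk.inj e).2
  · rintro ⟨x, y⟩ hp
    simp only [Finset.mem_filter, Finset.mem_product, hmem] at hp
    have hx : x = m.1 * y + m.2 := hp.2
    refine ⟨y, ?_, ?_⟩
    · simp only [rows, Finset.mem_filter]
      exact ⟨hp.1.2, hx ▸ hp.1.1⟩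
    · rw [hx]

lemma nonhor_bound (A B : Finset F) (L : Finset (Set (F × F)))
    (hL : ∀ l ∈ L, (∃ m : F × F, l = {p : F × F | p.1 = m.1 * p.2 + m.2}) ∧
      3 ≤ ((A ×ˢ B).filter fun p => p ∈ l).card) :
    (∑ l ∈ L, (((A ×ˢ B).filter fun p => p ∈ l).card : ℝ)) ^ 3 ≤
      (L.card : ℝ) ^ 2 * (5 * (trip A B : ℝ)) := by
  have hex : ∀ l ∈ L, ∃ m : F × F, l = {p : F × F | p.1 = m.1 * p.2 + m.2} := fun l hl => (hL l hl).1
  choose! m hm using hex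
  have hinj : Set.InjOn m (L : Set (Set (F × F))) := by
    intro l hl l' hl' e
    rw [hm l hl, hm l' hl', e]
  have hcard : ∀ l ∈ L, ((A ×ˢ B).filter fun p => p ∈ l).card = (rows A B (m l)).card := by
    intro l hl
    exact rows_card A B (m l) l (hm l hl)
  have h1 : ∑ l ∈ L, (((A ×ˢ B).filter fun p => p ∈ l).card) ^ 3 ≤ 5 * trip A B := by
    have e1 : ∀ l ∈ L, (((A ×ˢ B).filter fun p => p ∈ l).card) ^ 3 ≤
        5 * ∑ p ∈ (rows A B (m l)).offDiag, (rest (rows A B (m l)) p).card := by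
      intro l hl
      have h3 := (hL l hl).2
      rw [hcard l hl] at h3 ⊢
      rw [triple_card _ (by omega)]
      generalize (rows A B (m l)).card = i at h3
      obtain ⟨j, rfl⟩ := Nat.exists_eq_add_of_le h3
      have k1 : (3 + j) * (3 + j) - (3 + j) = (3 + j) * (2 + j) := by
        rw [Nat.sub_eq_iff_eq_add (by nlinarith)]
        ring
      have k2 : 3 + j - 2 = 1 + j := by omega
      rw [k1, k2]
      nlinarith [Nat.zero_le (j ^ 2), Nat.zero_le (j ^ 3)]
    refine (Finset.sum_le_sum e1).trans ?_
    rw [← Finset.mul_sum]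
    apply Nat.mul_le_mul_left
    have e2 := lines_trip A B (L.image m)
    rw [Finset.sum_image hinj] at e2
    exact e2
  have h2 := inner_pow_three L (fun l => (((A ×ˢ B).filter fun p => p ∈ l).card : ℝ))
    (fun l _ => Nat.cast_nonneg _)
  refine h2.trans ?_
  gcongr
  exact_mod_cast h1


lemma hor_bound (A B : Finset F) (L : Finset (Set (F × F)))
    (hL : ∀ l ∈ L, (∃ c : F, l = {p : F × F | p.2 = c}) ∧
      0 < ((A ×ˢ B).filter fun p => p ∈ l).card) :
    L.card ≤ B.card ∧ ∀ l ∈ L, ((A ×ˢ B).filter fun p => p ∈ l).card ≤ A.card := by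
  constructor
  · have hsub : L ⊆ B.image (fun c => {p : F × F | p.2 = c}) := by
      intro l hl
      obtain ⟨⟨c, hc⟩, hpos⟩ := hL l hl
      obtain ⟨p, hp⟩ := Finset.card_pos.1 hpos
      rw [Finset.mem_filter, Finset.mem_product] at hp
      rw [Finset.mem_image]
      refine ⟨c, ?_, hc.symm⟩
      have h2 : p.2 = c := by
        have := hp.2
        rw [hc] at this
        exact this
      rw [← h2]
      exact hp.1.2
    exact (Finset.card_le_card hsub).trans Finset.card_image_le
  · intro l hl
    obtain ⟨⟨c, hc⟩, _⟩ := hL l hl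
    apply Finset.card_le_card_of_injOn (fun p => p.1)
    · intro p hp
      rw [Finset.mem_coe, Finset.mem_filter, Finset.mem_product] at hp
      exact hp.1.1
    · intro p hp p' hp' e
      rw [Finset.mem_coe, Finset.mem_filter, Finset.mem_product, hc] at hp hp'
      have e1 : p.2 = c := hp.2
      have e2 : p'.2 = c := hp'.2
      exact Prod.ext e (e1.trans e2.symm)

lemma incid_split (A B : Finset F) (L : Finset (Set (F × F))) (hL : ∀ l ∈ L, IsLine l) :
    ∃ N : ℕ, ∃ S : ℝ, N ≤ B.card ∧ N ≤ L.card ∧ 0 ≤ S ∧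
      S ^ 3 ≤ (L.card : ℝ) ^ 2 * (5 * (trip A B : ℝ)) ∧
      (incidences (A ×ˢ B) L : ℝ) ≤ A.card * N + S + 2 * L.card := by
  set i : Set (F × F) → ℕ := fun l => ((A ×ˢ B).filter fun p => p ∈ l).card with hi
  set L1 := L.filter fun l => (∃ c : F, l = {p : F × F | p.2 = c}) ∧ 0 < i l with hL1
  set L2 := L.filter fun l => (∃ m : F × F, l = {p : F × F | p.1 = m.1 * p.2 + m.2}) ∧ 3 ≤ i l
    with hL2
  obtain ⟨h1, h2⟩ := hor_bound A B L1 (fun l hl => (Finset.mem_filter.1 hl).2)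
  have h3 := nonhor_bound A B L2 (fun l hl => (Finset.mem_filter.1 hl).2)
  have hS0 : (0:ℝ) ≤ ∑ l ∈ L2, (((A ×ˢ B).filter fun p => p ∈ l).card : ℝ) :=
    Finset.sum_nonneg fun l _ => Nat.cast_nonneg _
  refine ⟨L1.card, ∑ l ∈ L2, (((A ×ˢ B).filter fun p => p ∈ l).card : ℝ), h1,
    Finset.card_filter_le _ _, hS0, ?_, ?_⟩
  · refine h3.trans ?_
    have : (L2.card : ℝ) ≤ L.card := by exact_mod_cast Finset.card_filter_le _ _
    gcongr
  · have key : ∑ l ∈ L, i l ≤ A.card * L1.card + ∑ l ∈ L2, i l + 2 * L.card := by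
      have e : ∀ l ∈ L, i l ≤ (if (∃ c : F, l = {p : F × F | p.2 = c}) ∧ 0 < i l then A.card else 0)
          + (if (∃ m : F × F, l = {p : F × F | p.1 = m.1 * p.2 + m.2}) ∧ 3 ≤ i l then i l else 0)
          + 2 := by
        intro l hl
        by_cases k1 : (∃ c : F, l = {p : F × F | p.2 = c}) ∧ 0 < i l
        · have := h2 l (Finset.mem_filter.2 ⟨hl, k1⟩)
          rw [if_pos k1]
          change i l ≤ A.card at this
          omega
        · by_cases k2 : (∃ m : F × F, l = {p : F × F | p.1 = m.1 * p.2 + m.2}) ∧ 3 ≤ i l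
          · rw [if_pos k2]
            omega
          · have : i l ≤ 2 := by
              rcases line_cases l (hL l hl) with hc | hm
              · have : ¬ 0 < i l := fun h => k1 ⟨hc, h⟩
                omega
              · have : ¬ 3 ≤ i l := fun h => k2 ⟨hm, h⟩
                omega
            omega
      refine (Finset.sum_le_sum e).trans (le_of_eq ?_)
      rw [Finset.sum_add_distrib, Finset.sum_add_distrib, ← Finset.sum_filter, ← Finset.sum_filter,
        Finset.sum_const, Finset.sum_const, smul_eq_mul, smul_eq_mul, mul_comm, mul_comm _ 2]
    rw [incid_sum]
    exact_mod_cast key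

lemma rpow_facts (a b q : ℝ) (ha : 0 < a) (hb : 0 < b) (hq : 0 < q) :
    ∃ r w : ℝ, 0 ≤ r ∧ 0 ≤ w ∧ r ^ 191 * b ^ 2 = a ∧ w ^ 103 * q = a ∧
      a ^ ((31:ℝ)/191) * b ^ ((129:ℝ)/191) = r ^ 31 * b ∧
      (a ^ ((383:ℝ)/573) * b ^ ((571:ℝ)/573)) ^ 3 = a ^ 2 * b ^ 3 * r ∧
      (q ^ (-(1:ℝ)/309) * a ^ ((207:ℝ)/309) * b) ^ 3 = a ^ 2 * b ^ 3 * w := by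
  obtain ⟨u, rfl⟩ : ∃ u, a = Real.exp u := ⟨Real.log a, (Real.exp_log ha).symm⟩
  obtain ⟨v, rfl⟩ : ∃ u, b = Real.exp u := ⟨Real.log b, (Real.exp_log hb).symm⟩
  obtain ⟨z, rfl⟩ : ∃ u, q = Real.exp u := ⟨Real.log q, (Real.exp_log hq).symm⟩
  refine ⟨Real.exp ((u - 2 * v) / 191), Real.exp ((u - z) / 103), (Real.exp_pos _).le,
    (Real.exp_pos _).le, ?_, ?_, ?_, ?_, ?_⟩ <;>
  · simp only [← Real.exp_mul, ← Real.exp_nat_mul, ← Real.exp_add]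
    congr 1
    push_cast
    ring

theorem stmt1 : ∀ C : ℝ, 0 < C → ∃ C' : ℝ, 0 < C' ∧
    ∀ (F : Type) [Field F] [Fintype F] (q : ℕ), IsPrimePow q → Fintype.card F = q →
    ∀ A B : Finset F, 2 ≤ B.card → B.card ≤ A.card →
    subfieldCond A C ((A.card : ℝ) ^ ((31:ℝ)/191) * (B.card : ℝ) ^ ((129:ℝ)/191)) →
    ∀ L : Finset (Set (F × F)), (∀ l ∈ L, IsLine l) →
    (incidences (A ×ˢ B) L : ℝ) ≤
      C' * (((A.card : ℝ) ^ ((383:ℝ)/573) * (B.card : ℝ) ^ ((571:ℝ)/573)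
        + (q : ℝ) ^ (-(1:ℝ)/309) * (A.card : ℝ) ^ ((207:ℝ)/309) * (B.card : ℝ)
        + (A.card : ℝ) * (B.card : ℝ) ^ ((1:ℝ)/3)) * (L.card : ℝ) ^ ((2:ℝ)/3)
        + (L.card : ℝ)) := by
  intro C hC
  have hbig := bigc_pos
  have hbig1 : 1 ≤ bigc := by simpa using bigc_ge 0 (by norm_num)
  have hC1 : 1 ≤ (1 + C) ^ 2 := by nlinarith
  obtain ⟨D, hD⟩ : ∃ D : ℝ, D = 5 * (2 * bigc * (1 + C) ^ 2) := ⟨_, rfl⟩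
  have hD2 : 2 ≤ D := by
    rw [hD]
    nlinarith [mul_le_mul hbig1 hC1 zero_le_one hbig.le]
  refine ⟨D, by linarith, ?_⟩
  intro F _ _ q _ hFq A B hB2 hBA hsub L hL
  have hbn : 0 < B.card := by omega
  have han : 0 < A.card := by omega
  have hqn : 0 < q := by rw [← hFq]; exact Fintype.card_pos
  have hb : (0:ℝ) < B.card := by exact_mod_cast hbn
  have ha : (0:ℝ) < A.card := by exact_mod_cast han
  have hq : (0:ℝ) < q := by exact_mod_cast hqn
  have hba : (B.card : ℝ) ≤ A.card := by exact_mod_cast hBA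
  obtain ⟨r, w, hr, hw, hra, hwa, hM, hE1, hE2⟩ := rpow_facts (A.card : ℝ) B.card q ha hb hq
  have hcore := core A B A.card B.card q C _ r w (Finset.card_pos.1 hbn) rfl rfl
    (by rw [hFq]) hba hC hsub hr hw hra hwa hM
  obtain ⟨N, S, hNB, hNL, hS0, hS, hI⟩ := incid_split A B L hL
  clear hra hwa hM hsub
  have hE1n : 0 ≤ (A.card : ℝ) ^ ((383:ℝ)/573) * (B.card : ℝ) ^ ((571:ℝ)/573) := by positivity
  have hE2n : 0 ≤ (q : ℝ) ^ (-(1:ℝ)/309) * (A.card : ℝ) ^ ((207:ℝ)/309) * (B.card : ℝ) := by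
    positivity
  generalize (A.card : ℝ) ^ ((383:ℝ)/573) * (B.card : ℝ) ^ ((571:ℝ)/573) = E1 at *
  generalize (q : ℝ) ^ (-(1:ℝ)/309) * (A.card : ℝ) ^ ((207:ℝ)/309) * (B.card : ℝ) = E2 at *
  have hl3 : ((L.card : ℝ) ^ ((2:ℝ)/3)) ^ 3 = (L.card : ℝ) ^ 2 := by
    rw [← Real.rpow_natCast, ← Real.rpow_mul (by positivity)]
    norm_num
  have hl0 : (0:ℝ) ≤ (L.card : ℝ) ^ ((2:ℝ)/3) := by positivity
  have hN : (A.card : ℝ) * N ≤ A.card * (B.card : ℝ) ^ ((1:ℝ)/3) * (L.card : ℝ) ^ ((2:ℝ)/3) := by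
    rw [mul_assoc]
    apply mul_le_mul_of_nonneg_left _ ha.le
    have e1 : (N : ℝ) = (N : ℝ) ^ ((1:ℝ)/3) * (N : ℝ) ^ ((2:ℝ)/3) := by
      rw [← Real.rpow_add_of_nonneg (by positivity) (by norm_num) (by norm_num)]
      norm_num
    have e2 : (N : ℝ) ≤ B.card := by exact_mod_cast hNB
    have e3 : (N : ℝ) ≤ L.card := by exact_mod_cast hNL
    rw [e1]
    exact mul_le_mul (Real.rpow_le_rpow (Nat.cast_nonneg _) e2 (by norm_num))
      (Real.rpow_le_rpow (Nat.cast_nonneg _) e3 (by norm_num))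
      (Real.rpow_nonneg (Nat.cast_nonneg _) _) (Real.rpow_nonneg (Nat.cast_nonneg _) _)
  generalize (L.card : ℝ) ^ ((2:ℝ)/3) = ℓ at *
  have hE3n : 0 ≤ (A.card : ℝ) * (B.card : ℝ) ^ ((1:ℝ)/3) := by positivity
  generalize (A.card : ℝ) * (B.card : ℝ) ^ ((1:ℝ)/3) = E3 at *
  have hSle : S ≤ D * (ℓ * (E1 + E2)) := by
    have e1 : S ^ 3 ≤ (D * (ℓ * (E1 + E2))) ^ 3 := by
      calc S ^ 3 ≤ ℓ ^ 3 * (5 * (trip A B : ℝ)) := by rw [hl3]; exact hS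
        _ ≤ ℓ ^ 3 * (5 * (2 * bigc * (1 + C) ^ 2 * ((A.card : ℝ) ^ 2 * (B.card : ℝ) ^ 3)
              * (r + w))) := by gcongr
        _ = ℓ ^ 3 * (D * (E1 ^ 3 + E2 ^ 3)) := by rw [hE1, hE2, hD]; ring
        _ ≤ ℓ ^ 3 * (D ^ 3 * (E1 + E2) ^ 3) := by
          have k1 : D ≤ D ^ 3 := le_self_pow₀ (by linarith) (by norm_num)
          have k2 : E1 ^ 3 + E2 ^ 3 ≤ (E1 + E2) ^ 3 := by
            have : 0 ≤ E1 * E2 * (E1 + E2) := by positivity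
            nlinarith
          have k3 : 0 ≤ D := by linarith
          gcongr
        _ = _ := by ring
    have k3 : 0 ≤ D := by linarith
    exact (pow_le_pow_iff_left₀ hS0 (by positivity) (by norm_num)).1 e1
  have hL0 : (0:ℝ) ≤ L.card := by positivity
  have f1 : E3 * ℓ ≤ D * (E3 * ℓ) := le_mul_of_one_le_left (by positivity) (by linarith)
  have f2 : 2 * (L.card : ℝ) ≤ D * L.card := by gcongr
  calc (incidences (A ×ˢ B) L : ℝ) ≤ A.card * N + S + 2 * L.card := hI
    _ ≤ D * (E3 * ℓ) + D * (ℓ * (E1 + E2)) + D * L.card := by linarith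
    _ = _ := by ring

end STP
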